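/- arXiv:2308.03178 — 2 statements merged into one kernel-verified Lean document; each statement's English description precedes it below -/
import Mathlib

section
/- Let X be a real Banach space that has infratype p with constant C for some p > 1, and let F : [0,1] → 2^X \ {∅} be a bounded multifunction. Then I(F) = I(conv F). -/
open Pointwise Filter Metric Set

/-- A tagged partition of `[0,1]` into finitely many segments with tags. -/
structure TaggedPartition where
  n : ℕ
  pt : Fin (n + 1) → ℝ
  tag : Fin n → ℝ
  pt_zero : pt 0 = 0
  pt_last : pt (Fin.last n) = 1
  pt_mono : Monotone pt
  tag_mem : ∀ i : Fin n, tag i ∈ Set.Icc (pt i.castSucc) (pt i.succ)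

/-- The diameter (mesh) of a tagged partition. -/
noncomputable def TaggedPartition.mesh (P : TaggedPartition) : ℝ :=
  ⨆ i : Fin P.n, (P.pt i.succ - P.pt i.castSucc)

/-- Riemann integral sum of a multifunction, using Minkowski sums and
pointwise scalar multiples of sets. -/
noncomputable def msum {X : Type*} [NormedAddCommGroup X] [NormedSpace ℝ X]
    (F : ℝ → Set X) (P : TaggedPartition) : Set X :=
  ∑ i : Fin P.n, (P.pt i.succ - P.pt i.castSucc) • F (P.tag i)

/-- The set `I(F)` of limits of Riemann integral sums of a multifunction `F`:
all closed nonempty subsets that are Hausdorff-distance limits of sequences of Riemann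
sums along sequences of tagged partitions whose diameters tend to `0`. -/
def limitSets {X : Type*} [NormedAddCommGroup X] [NormedSpace ℝ X]
    (F : ℝ → Set X) : Set (Set X) :=
  {A | A.Nonempty ∧ IsClosed A ∧ ∃ P : ℕ → TaggedPartition,
    Tendsto (fun k => (P k).mesh) atTop (nhds 0) ∧
    Tendsto (fun k => EMetric.hausdorffEdist (msum F (P k)) A) atTop (nhds 0)}

theorem exists_sign_norm_sum_le_of_fintype {X : Type*} [NormedAddCommGroup X] [NormedSpace ℝ X]
    {p C : ℝ}
    (hinfra : ∀ (n : ℕ) (x : Fin n → X), ∃ a : Fin n → ℝ,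
      (∀ i, a i = 1 ∨ a i = -1) ∧
      ‖∑ i, a i • x i‖ ≤ C * (∑ i, ‖x i‖ ^ p) ^ (1 / p))
    {ι : Type*} [Fintype ι] (x : ι → X) :
    ∃ a : ι → ℝ, (∀ i, a i = 1 ∨ a i = -1) ∧
      ‖∑ i, a i • x i‖ ≤ |C| * (∑ i, ‖x i‖ ^ p) ^ (1 / p) := by
  let e := Fintype.equivFin ι
  obtain ⟨a, ha, h⟩ := hinfra _ (x ∘ e.symm)
  refine ⟨a ∘ e, fun i => ha _, ?_⟩
  have h₁ : ∑ i, (a ∘ e) i • x i = ∑ i, a i • (x ∘ e.symm) i :=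
    Fintype.sum_equiv e _ _ (by simp)
  have h₂ : ∑ i, ‖x i‖ ^ p = ∑ i, ‖(x ∘ e.symm) i‖ ^ p :=
    Fintype.sum_equiv e _ _ (by simp)
  rw [h₁, h₂]
  refine h.trans (mul_le_mul_of_nonneg_right (le_abs_self C) ?_)
  positivity

theorem Finset.sum_range_two_mul_eq_sum_add {E : Type*} [AddCommMonoid E] (f : ℕ → E) (m : ℕ) :
    ∑ j ∈ Finset.range (2 * m), f j = ∑ j ∈ Finset.range m, (f (2 * j) + f (2 * j + 1)) := by
  induction m with
  | zero => simp
  | succ m ih =>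
    rw [Finset.sum_range_succ, ← ih, Nat.mul_succ, Finset.sum_range_succ, Finset.sum_range_succ,
      add_assoc]

/-- The averages of `2 ^ N` points of `A`, repetitions allowed. -/
def dyadicAverages {E : Type*} [AddCommGroup E] [Module ℝ E] (A : Set E) (N : ℕ) : Set E :=
  {x | ∃ a : ℕ → E, (∀ j, a j ∈ A) ∧ x = ((2 : ℝ) ^ N)⁻¹ • ∑ j ∈ Finset.range (2 ^ N), a j}

section DyadicAverages

variable {E : Type*} [NormedAddCommGroup E] [NormedSpace ℝ E] {A : Set E}

theorem half_smul_add_mem_dyadicAverages {N : ℕ} {x y : E} (hx : x ∈ dyadicAverages A N)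
    (hy : y ∈ dyadicAverages A N) : (1 / 2 : ℝ) • (x + y) ∈ dyadicAverages A (N + 1) := by
  obtain ⟨a, ha, rfl⟩ := hx
  obtain ⟨b, hb, rfl⟩ := hy
  refine ⟨fun j => if j < 2 ^ N then a j else b (j - 2 ^ N), fun j => ?_, ?_⟩
  · dsimp only
    split_ifs
    exacts [ha _, hb _]
  · have h₁ : ∑ j ∈ Finset.range (2 ^ N), (if j < 2 ^ N then a j else b (j - 2 ^ N))
        = ∑ j ∈ Finset.range (2 ^ N), a j :=
      Finset.sum_congr rfl fun j hj => if_pos (Finset.mem_range.1 hj)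
    rw [show (2 : ℕ) ^ (N + 1) = 2 ^ N + 2 ^ N by ring, Finset.sum_range_add, h₁]
    simp only [add_lt_iff_neg_left, not_lt_zero, if_false, add_tsub_cancel_left]
    rw [← smul_add, smul_smul]
    congr 1
    rw [pow_succ, mul_inv, mul_comm, one_div]

theorem monotone_dyadicAverages : Monotone (dyadicAverages A) := by
  refine monotone_nat_of_le_succ fun N x hx => ?_
  have h := half_smul_add_mem_dyadicAverages hx hx
  rwa [← two_smul ℝ x, smul_smul, one_div, inv_mul_cancel₀ two_ne_zero, one_smul] at h

theorem half_smul_add_mem_iUnion_dyadicAverages {x y : E} (hx : x ∈ ⋃ N, dyadicAverages A N)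
    (hy : y ∈ ⋃ N, dyadicAverages A N) : (1 / 2 : ℝ) • (x + y) ∈ ⋃ N, dyadicAverages A N := by
  obtain ⟨N, hN⟩ := Set.mem_iUnion.1 hx
  obtain ⟨K, hK⟩ := Set.mem_iUnion.1 hy
  exact Set.mem_iUnion.2 ⟨max N K + 1, half_smul_add_mem_dyadicAverages
    (monotone_dyadicAverages (le_max_left N K) hN) (monotone_dyadicAverages (le_max_right N K) hK)⟩

/-- A closed set stable under midpoints is convex. -/
theorem IsClosed.convex_of_half_smul_add_mem {S : Set E} (hS : IsClosed S)
    (h : ∀ x ∈ S, ∀ y ∈ S, (1 / 2 : ℝ) • (x + y) ∈ S) : Convex ℝ S := by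
  intro x hx y hy s t hs ht hst
  obtain rfl : s = 1 - t := by linarith
  have approx : ∀ (n : ℕ) (t : ℝ), 0 ≤ t → t ≤ 1 →
      ∃ z ∈ S, ‖(1 - t) • x + t • y - z‖ ≤ (1 / 2) ^ n * ‖x - y‖ := by
    intro n
    induction n with
    | zero =>
      intro t h0 h1
      refine ⟨y, hy, ?_⟩
      rw [show (1 - t) • x + t • y - y = (1 - t) • (x - y) by module, norm_smul,
        Real.norm_of_nonneg (by linarith), pow_zero]
      exact mul_le_mul_of_nonneg_right (by linarith) (norm_nonneg _)
    | succ n ih =>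
      intro t h0 h1
      rcases le_total t (1 / 2) with ht | ht
      · obtain ⟨z, hz, hzn⟩ := ih (2 * t) (by linarith) (by linarith)
        refine ⟨(1 / 2 : ℝ) • (x + z), h x hx z hz, ?_⟩
        rw [show (1 - t) • x + t • y - (1 / 2 : ℝ) • (x + z)
          = (1 / 2 : ℝ) • ((1 - 2 * t) • x + (2 * t) • y - z) by module, norm_smul,
          Real.norm_of_nonneg (by norm_num), pow_succ]
        linarith
      · obtain ⟨z, hz, hzn⟩ := ih (2 * t - 1) (by linarith) (by linarith)
        refine ⟨(1 / 2 : ℝ) • (y + z), h y hy z hz, ?_⟩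
        rw [show (1 - t) • x + t • y - (1 / 2 : ℝ) • (y + z)
          = (1 / 2 : ℝ) • ((1 - (2 * t - 1)) • x + (2 * t - 1) • y - z) by module, norm_smul,
          Real.norm_of_nonneg (by norm_num), pow_succ]
        linarith
  choose z hz hzn using fun n => approx n t ht (by linarith)
  refine hS.mem_of_tendsto (b := atTop) (f := z) ?_ (Eventually.of_forall hz)
  rw [tendsto_iff_norm_sub_tendsto_zero]
  refine squeeze_zero (g := fun n => (1 / 2) ^ n * ‖x - y‖) (fun n => norm_nonneg _)
    (fun n => ?_) ?_
  · rw [norm_sub_rev]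
    exact hzn n
  · simpa using (tendsto_pow_atTop_nhds_zero_of_lt_one (r := (1 / 2 : ℝ)) (by norm_num)
      (by norm_num)).mul_const ‖x - y‖

theorem convexHull_subset_closure_iUnion_dyadicAverages :
    convexHull ℝ A ⊆ closure (⋃ N, dyadicAverages A N) := by
  refine convexHull_min (fun x hx => subset_closure ?_)
    (isClosed_closure.convex_of_half_smul_add_mem fun x hx y hy => ?_)
  · exact Set.mem_iUnion.2 ⟨0, fun _ => x, fun _ => hx, by simp⟩
  · exact map_mem_closure₂ (f := fun x y : E => (1 / 2 : ℝ) • (x + y)) (by fun_prop) hx hy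
      fun a ha b hb => half_smul_add_mem_iUnion_dyadicAverages ha hb

end DyadicAverages

section Infratype

variable {X : Type*} [NormedAddCommGroup X] [NormedSpace ℝ X] {p C : ℝ}
  {ι : Type*} [Fintype ι] {A : ι → Set X} {r : ι → ℝ}

/-- Halving the number of averaged points, by selecting one point out of each consecutive pair. -/
theorem exists_norm_sum_sub_le_of_halving (hp : 1 < p)
    (hinfra : ∀ (n : ℕ) (x : Fin n → X), ∃ a : Fin n → ℝ,
      (∀ i, a i = 1 ∨ a i = -1) ∧
      ‖∑ i, a i • x i‖ ≤ C * (∑ i, ‖x i‖ ^ p) ^ (1 / p))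
    (hr : ∀ i, 0 ≤ r i) (hA : ∀ i, ∀ x ∈ A i, ∀ y ∈ A i, ‖x - y‖ ≤ r i)
    (N : ℕ) {x : ι → X} (hx : x ∈ dyadicAverages (Set.univ.pi A) (N + 1)) :
    ∃ y ∈ dyadicAverages (Set.univ.pi A) N,
      ‖∑ i, x i - ∑ i, y i‖ ≤
        |C| / 2 * (∑ i, r i ^ p) ^ (1 / p) * ((2 : ℝ) ^ (1 / p - 1)) ^ N := by
  obtain ⟨a, ha, rfl⟩ := hx
  let v : ι × Fin (2 ^ N) → X := fun q =>
    ((2 : ℝ) ^ (N + 1))⁻¹ • (a (2 * q.2) q.1 - a (2 * q.2 + 1) q.1)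
  obtain ⟨s, hs, hsv⟩ := exists_sign_norm_sum_le_of_fintype hinfra v
  let b : ℕ → ι → X := fun j i =>
    if h : j < 2 ^ N then
      if s (i, ⟨j, h⟩) = 1 then a (2 * j) i else a (2 * j + 1) i
    else a 0 i
  have hb : ∀ j, b j ∈ Set.univ.pi A := by
    intro j i _
    dsimp only [b]
    split_ifs
    exacts [ha _ i trivial, ha _ i trivial, ha _ i trivial]
  refine ⟨_, ⟨b, hb, rfl⟩, ?_⟩
  have hpair : ∀ i (j : Fin (2 ^ N)),
      ((2 : ℝ) ^ N)⁻¹ • b j i - ((2 : ℝ) ^ (N + 1))⁻¹ • (a (2 * j) i + a (2 * j + 1) i)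
        = s (i, j) • v (i, j) := by
    intro i j
    have h2 : ((2 : ℝ) ^ N)⁻¹ = 2 * ((2 : ℝ) ^ (N + 1))⁻¹ := by
      rw [pow_succ]; field_simp
    rw [h2]
    dsimp only [b, v]
    rw [dif_pos j.2]
    rcases hs (i, j) with h | h
    · rw [if_pos h, h]
      module
    · rw [if_neg (by rw [h]; norm_num), h]
      module
  have hsum : ∑ i, (((2 : ℝ) ^ N)⁻¹ • ∑ j ∈ Finset.range (2 ^ N), b j) i
      - ∑ i, (((2 : ℝ) ^ (N + 1))⁻¹ • ∑ j ∈ Finset.range (2 ^ (N + 1)), a j) i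
        = ∑ q, s q • v q := by
    rw [Fintype.sum_prod_type, ← Finset.sum_sub_distrib]
    refine Finset.sum_congr rfl fun i _ => ?_
    rw [show (2 : ℕ) ^ (N + 1) = 2 * 2 ^ N by ring, Finset.sum_range_two_mul_eq_sum_add, Finset.sum_range, Finset.sum_range]
    simp only [Pi.smul_apply, Finset.sum_apply, Pi.add_apply, Finset.smul_sum]
    rw [← Finset.sum_sub_distrib]
    refine Finset.sum_congr rfl fun j _ => ?_
    rw [← hpair]
  rw [norm_sub_rev, hsum]
  refine hsv.trans ?_
  have hp0 : 0 < p := by linarith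
  have hR : 0 ≤ ∑ i, r i ^ p := Finset.sum_nonneg fun i _ => Real.rpow_nonneg (hr i) p
  have hv : ∑ q, ‖v q‖ ^ p ≤ 2 ^ N * ((((2 : ℝ) ^ (N + 1))⁻¹) ^ p * ∑ i, r i ^ p) := by
    calc ∑ q, ‖v q‖ ^ p
        ≤ ∑ q : ι × Fin (2 ^ N), (((2 : ℝ) ^ (N + 1))⁻¹) ^ p * r q.1 ^ p := by
          refine Finset.sum_le_sum fun q _ => ?_
          rw [← Real.mul_rpow (by positivity) (hr _)]
          refine Real.rpow_le_rpow (norm_nonneg _) ?_ hp0.le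
          rw [norm_smul, Real.norm_of_nonneg (by positivity)]
          exact mul_le_mul_of_nonneg_left
            (hA _ _ (ha _ _ trivial) _ (ha _ _ trivial)) (by positivity)
      _ = _ := by
          rw [Fintype.sum_prod_type]
          simp [Finset.mul_sum]
  have hroot : (∑ q, ‖v q‖ ^ p) ^ (1 / p) ≤
      1 / 2 * ((2 : ℝ) ^ (1 / p - 1)) ^ N * (∑ i, r i ^ p) ^ (1 / p) := by
    refine (Real.rpow_le_rpow (by positivity) hv (by positivity)).trans_eq ?_
    rw [Real.mul_rpow (by positivity) (by positivity), Real.mul_rpow (by positivity) hR,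
      ← Real.rpow_mul (by positivity), mul_one_div_cancel hp0.ne', Real.rpow_one, ← mul_assoc]
    congr 1
    rw [Real.rpow_sub_one two_ne_zero, div_pow, ← Real.rpow_natCast ((2 : ℝ) ^ (1 / p)) N,
      ← Real.rpow_mul two_pos.le, ← Real.rpow_natCast 2 N, ← Real.rpow_mul two_pos.le,
      mul_comm (N : ℝ), Real.rpow_natCast, pow_succ]
    field_simp
  calc |C| * (∑ q, ‖v q‖ ^ p) ^ (1 / p)
      ≤ |C| * (1 / 2 * ((2 : ℝ) ^ (1 / p - 1)) ^ N * (∑ i, r i ^ p) ^ (1 / p)) :=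
        mul_le_mul_of_nonneg_left hroot (abs_nonneg C)
    _ = _ := by ring

theorem exists_mem_pi_norm_sum_sub_le_of_dyadicAverages (hp : 1 < p)
    (hinfra : ∀ (n : ℕ) (x : Fin n → X), ∃ a : Fin n → ℝ,
      (∀ i, a i = 1 ∨ a i = -1) ∧
      ‖∑ i, a i • x i‖ ≤ C * (∑ i, ‖x i‖ ^ p) ^ (1 / p))
    (hr : ∀ i, 0 ≤ r i) (hA : ∀ i, ∀ x ∈ A i, ∀ y ∈ A i, ‖x - y‖ ≤ r i)
    (N : ℕ) {x : ι → X} (hx : x ∈ dyadicAverages (Set.univ.pi A) N) :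
    ∃ y ∈ Set.univ.pi A, ‖∑ i, x i - ∑ i, y i‖ ≤
      |C| / 2 * (∑ i, r i ^ p) ^ (1 / p) *
        ∑ k ∈ Finset.range N, ((2 : ℝ) ^ (1 / p - 1)) ^ k := by
  induction N generalizing x with
  | zero =>
    obtain ⟨a, ha, rfl⟩ := hx
    exact ⟨a 0, ha 0, by simp⟩
  | succ N ih =>
    obtain ⟨z, hz, hxz⟩ := exists_norm_sum_sub_le_of_halving hp hinfra hr hA N hx
    obtain ⟨y, hy, hzy⟩ := ih hz
    refine ⟨y, hy, (norm_sub_le_norm_sub_add_norm_sub _ (∑ i, z i) _).trans ?_⟩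
    rw [Finset.sum_range_succ, mul_add, add_comm]
    exact add_le_add hzy hxz

/-- A Shapley–Folkman type estimate in spaces of infratype `p > 1`. -/
theorem exists_mem_pi_norm_sum_sub_le_of_convexHull (hp : 1 < p)
    (hinfra : ∀ (n : ℕ) (x : Fin n → X), ∃ a : Fin n → ℝ,
      (∀ i, a i = 1 ∨ a i = -1) ∧
      ‖∑ i, a i • x i‖ ≤ C * (∑ i, ‖x i‖ ^ p) ^ (1 / p))
    (hr : ∀ i, 0 ≤ r i) (hA : ∀ i, ∀ x ∈ A i, ∀ y ∈ A i, ‖x - y‖ ≤ r i)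
    {x : ι → X} (hx : ∀ i, x i ∈ convexHull ℝ (A i)) {ε : ℝ} (hε : 0 < ε) :
    ∃ y : ι → X, (∀ i, y i ∈ A i) ∧ ‖∑ i, x i - ∑ i, y i‖ ≤
      |C| / 2 * (1 - (2 : ℝ) ^ (1 / p - 1))⁻¹ * (∑ i, r i ^ p) ^ (1 / p) + ε := by
  have hxpi : x ∈ convexHull ℝ (Set.univ.pi A) := mem_convexHull_pi fun i _ => hx i
  have hxcl := convexHull_subset_closure_iUnion_dyadicAverages hxpi
  have hcont : Continuous fun z : ι → X => ∑ i, z i := by fun_prop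
  obtain ⟨w, ⟨z, hz, rfl⟩, hzε⟩ :=
    Metric.mem_closure_iff.1 (image_closure_subset_closure_image hcont ⟨x, hxcl, rfl⟩) ε hε
  obtain ⟨N, hN⟩ := Set.mem_iUnion.1 hz
  obtain ⟨y, hy, hzy⟩ := exists_mem_pi_norm_sum_sub_le_of_dyadicAverages hp hinfra hr hA N hN
  refine ⟨y, fun i => hy i trivial, ?_⟩
  rw [dist_eq_norm] at hzε
  have hR : 0 ≤ ∑ i, r i ^ p := Finset.sum_nonneg fun i _ => Real.rpow_nonneg (hr i) p
  have hq : (2 : ℝ) ^ (1 / p - 1) < 1 :=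
    Real.rpow_lt_one_of_one_lt_of_neg one_lt_two
      (sub_neg.2 ((div_lt_one (by linarith)).2 hp))
  have hgeom : ∑ k ∈ Finset.range N, ((2 : ℝ) ^ (1 / p - 1)) ^ k
      ≤ (1 - (2 : ℝ) ^ (1 / p - 1))⁻¹ := by
    rw [← tsum_geometric_of_lt_one (by positivity) hq]
    exact (summable_geometric_of_lt_one (by positivity) hq).sum_le_tsum _
      fun k _ => by positivity
  have hbound := hzy.trans (mul_le_mul_of_nonneg_left hgeom
    (mul_nonneg (by positivity) (Real.rpow_nonneg hR _)))
  refine (norm_sub_le_norm_sub_add_norm_sub _ (∑ i, z i) _).trans ?_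
  rw [mul_right_comm, add_comm]
  exact add_le_add hbound hzε.le

end Infratype

namespace TaggedPartition

variable (P : TaggedPartition)

theorem length_nonneg (i : Fin P.n) : 0 ≤ P.pt i.succ - P.pt i.castSucc :=
  sub_nonneg.2 (P.pt_mono (Fin.castSucc_le_succ i))

theorem length_le_mesh (i : Fin P.n) : P.pt i.succ - P.pt i.castSucc ≤ P.mesh :=
  le_ciSup (f := fun i : Fin P.n => P.pt i.succ - P.pt i.castSucc) (Set.finite_range _).bddAbove i

theorem mesh_nonneg : 0 ≤ P.mesh := Real.iSup_nonneg P.length_nonneg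

theorem sum_length : ∑ i : Fin P.n, (P.pt i.succ - P.pt i.castSucc) = 1 := by
  have h₁ := Fin.sum_univ_succ P.pt
  have h₂ := Fin.sum_univ_castSucc P.pt
  rw [Finset.sum_sub_distrib]
  linarith [P.pt_zero, P.pt_last]

theorem tag_mem_Icc (i : Fin P.n) : P.tag i ∈ Set.Icc (0 : ℝ) 1 :=
  ⟨(P.pt_zero.ge.trans (P.pt_mono (Fin.zero_le _))).trans (P.tag_mem i).1,
    (P.tag_mem i).2.trans ((P.pt_mono (Fin.le_last _)).trans P.pt_last.le)⟩

theorem rpow_sum_rpow_length_le {p M : ℝ} (hp : 1 < p) (hM : 0 ≤ M) :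
    (∑ i : Fin P.n, ((P.pt i.succ - P.pt i.castSucc) * M) ^ p) ^ (1 / p)
      ≤ M * P.mesh ^ ((p - 1) / p) := by
  have hp0 : 0 < p := by linarith
  have hsum : ∑ i : Fin P.n, ((P.pt i.succ - P.pt i.castSucc) * M) ^ p
      ≤ M ^ p * P.mesh ^ (p - 1) := by
    calc ∑ i : Fin P.n, ((P.pt i.succ - P.pt i.castSucc) * M) ^ p
        ≤ ∑ i : Fin P.n, M ^ p * P.mesh ^ (p - 1) * (P.pt i.succ - P.pt i.castSucc) := by
          refine Finset.sum_le_sum fun i _ => ?_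
          have hi := P.length_nonneg i
          rw [Real.mul_rpow hi hM, mul_comm, mul_assoc]
          refine mul_le_mul_of_nonneg_left ?_ (by positivity)
          nth_rewrite 1 [show p = (p - 1) + 1 by ring]
          rw [Real.rpow_add_one' hi (by linarith)]
          exact mul_le_mul_of_nonneg_right
            (Real.rpow_le_rpow hi (P.length_le_mesh i) (by linarith)) hi
      _ = M ^ p * P.mesh ^ (p - 1) := by rw [← Finset.mul_sum, P.sum_length, mul_one]
  have h0 : 0 ≤ ∑ i : Fin P.n, ((P.pt i.succ - P.pt i.castSucc) * M) ^ p :=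
    Finset.sum_nonneg fun i _ => Real.rpow_nonneg (mul_nonneg (P.length_nonneg i) hM) p
  refine (Real.rpow_le_rpow h0 hsum (by positivity)).trans_eq ?_
  have hmesh := P.mesh_nonneg
  rw [Real.mul_rpow (by positivity) (by positivity), ← Real.rpow_mul hM, ← Real.rpow_mul hmesh,
    mul_one_div_cancel hp0.ne', Real.rpow_one, mul_one_div]

end TaggedPartition

section LimitSets

variable {X : Type*} [NormedAddCommGroup X] [NormedSpace ℝ X]

theorem hausdorffEDist_msum_convexHull_le {p C M : ℝ} (hp : 1 < p)
    (hinfra : ∀ (n : ℕ) (x : Fin n → X), ∃ a : Fin n → ℝ,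
      (∀ i, a i = 1 ∨ a i = -1) ∧
      ‖∑ i, a i • x i‖ ≤ C * (∑ i, ‖x i‖ ^ p) ^ (1 / p))
    {F : ℝ → Set X} (hM : 0 ≤ M) (hF : ∀ t ∈ Set.Icc (0 : ℝ) 1, ∀ a ∈ F t, ‖a‖ ≤ M)
    (P : TaggedPartition) :
    Metric.hausdorffEDist (msum F P) (msum (fun t => convexHull ℝ (F t)) P) ≤
      ENNReal.ofReal (|C| / 2 * (1 - (2 : ℝ) ^ (1 / p - 1))⁻¹ *
        (2 * M * P.mesh ^ ((p - 1) / p))) := by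
  have hq : 0 ≤ 1 - (2 : ℝ) ^ (1 / p - 1) :=
    sub_nonneg.2 (Real.rpow_lt_one_of_one_lt_of_neg one_lt_two
      (sub_neg.2 ((div_lt_one (by linarith)).2 hp))).le
  have hmesh := P.mesh_nonneg
  refine ENNReal.le_of_forall_pos_le_add fun ε hε _ => ?_
  rw [← ENNReal.ofReal_coe_nnreal, ← ENNReal.ofReal_add (by positivity) ε.coe_nonneg]
  refine hausdorffEDist_le_of_mem_edist (fun x hx => ⟨x, ?_, by simp⟩) fun x hx => ?_
  · exact Set.finsetSum_subset_finsetSum _ _ _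
      (fun i _ => Set.smul_set_mono (subset_convexHull ℝ _)) hx
  · obtain ⟨x, hxmem, rfl⟩ := (Set.mem_fintype_sum _ _).1 hx
    have hx' : ∀ i, x i ∈
        convexHull ℝ ((P.pt i.succ - P.pt i.castSucc) • F (P.tag i)) := fun i => by
      rw [convexHull_smul]
      exact hxmem i
    have hdiam : ∀ i, ∀ y ∈ (P.pt i.succ - P.pt i.castSucc) • F (P.tag i),
        ∀ z ∈ (P.pt i.succ - P.pt i.castSucc) • F (P.tag i),
        ‖y - z‖ ≤ (P.pt i.succ - P.pt i.castSucc) * (2 * M) := by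
      rintro i _ ⟨y, hy, rfl⟩ _ ⟨z, hz, rfl⟩
      dsimp only
      rw [← smul_sub, norm_smul, Real.norm_of_nonneg (P.length_nonneg i)]
      refine mul_le_mul_of_nonneg_left ((norm_sub_le _ _).trans ?_) (P.length_nonneg i)
      linarith [hF _ (P.tag_mem_Icc i) y hy, hF _ (P.tag_mem_Icc i) z hz]
    obtain ⟨y, hy, hxy⟩ := exists_mem_pi_norm_sum_sub_le_of_convexHull hp hinfra
      (fun i => mul_nonneg (P.length_nonneg i) (by positivity)) hdiam hx' (NNReal.coe_pos.2 hε)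
    refine ⟨∑ i, y i, (Set.mem_fintype_sum _ _).2 ⟨y, hy, rfl⟩, ?_⟩
    rw [edist_dist, dist_eq_norm]
    refine ENNReal.ofReal_le_ofReal (hxy.trans ?_)
    have := P.rpow_sum_rpow_length_le hp (mul_nonneg zero_le_two hM)
    gcongr

theorem tendsto_hausdorffEDist_msum_convexHull {p C : ℝ} (hp : 1 < p)
    (hinfra : ∀ (n : ℕ) (x : Fin n → X), ∃ a : Fin n → ℝ,
      (∀ i, a i = 1 ∨ a i = -1) ∧
      ‖∑ i, a i • x i‖ ≤ C * (∑ i, ‖x i‖ ^ p) ^ (1 / p))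
    {F : ℝ → Set X} (hF : ∃ M : ℝ, ∀ t ∈ Set.Icc (0 : ℝ) 1, ∀ a ∈ F t, ‖a‖ ≤ M)
    {P : ℕ → TaggedPartition} (hP : Tendsto (fun k => (P k).mesh) atTop (nhds 0)) :
    Tendsto (fun k => Metric.hausdorffEDist (msum F (P k))
      (msum (fun t => convexHull ℝ (F t)) (P k))) atTop (nhds 0) := by
  obtain ⟨M, hM⟩ := hF
  have hexp : 0 < (p - 1) / p := div_pos (by linarith) (by linarith)
  have hlim := hP.rpow_const (p := (p - 1) / p) (Or.inr hexp.le)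
  rw [Real.zero_rpow hexp.ne'] at hlim
  have hlim' := ENNReal.tendsto_ofReal ((hlim.const_mul (2 * max M 0)).const_mul
    (|C| / 2 * (1 - (2 : ℝ) ^ (1 / p - 1))⁻¹))
  rw [mul_zero, mul_zero, ENNReal.ofReal_zero] at hlim'
  exact tendsto_of_tendsto_of_tendsto_of_le_of_le tendsto_const_nhds hlim' (fun _ => zero_le)
    fun k => hausdorffEDist_msum_convexHull_le hp hinfra (le_max_right M 0)
      (fun t ht a ha => (hM t ht a ha).trans (le_max_left M 0)) (P k)

theorem limitSets_subset_limitSets_of_tendsto {F G : ℝ → Set X}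
    (h : ∀ P : ℕ → TaggedPartition, Tendsto (fun k => (P k).mesh) atTop (nhds 0) →
      Tendsto (fun k => Metric.hausdorffEDist (msum G (P k)) (msum F (P k))) atTop (nhds 0)) :
    limitSets F ⊆ limitSets G := by
  rintro A ⟨hne, hcl, P, hP, hA⟩
  have hsum := (h P hP).add hA
  rw [add_zero] at hsum
  exact ⟨hne, hcl, P, hP, tendsto_of_tendsto_of_tendsto_of_le_of_le tendsto_const_nhds hsum
    (fun _ => zero_le) fun _ => hausdorffEDist_triangle⟩

end LimitSets

/-- In a Banach space of nontrivial infratype `p > 1`, every bounded multifunction `F`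
on `[0,1]` satisfies `I(F) = I(conv F)`. -/
theorem limitSets_eq_limitSets_convexHull_of_infratype
    {X : Type*} [NormedAddCommGroup X] [NormedSpace ℝ X] [CompleteSpace X]
    (p C : ℝ) (hp : 1 < p)
    (hinfra : ∀ (n : ℕ) (x : Fin n → X), ∃ a : Fin n → ℝ,
      (∀ i, a i = 1 ∨ a i = -1) ∧
      ‖∑ i, a i • x i‖ ≤ C * (∑ i, ‖x i‖ ^ p) ^ (1 / p))
    (F : ℝ → Set X)
    (hFne : ∀ t ∈ Set.Icc (0 : ℝ) 1, (F t).Nonempty)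
    (hFbdd : ∃ M : ℝ, ∀ t ∈ Set.Icc (0 : ℝ) 1, ∀ a ∈ F t, ‖a‖ ≤ M) :
    limitSets F = limitSets (fun t => convexHull ℝ (F t)) := by
  have key := fun (P : ℕ → TaggedPartition) (hP : Tendsto (fun k => (P k).mesh) atTop (nhds 0)) =>
    tendsto_hausdorffEDist_msum_convexHull hp hinfra hFbdd hP
  refine Set.Subset.antisymm (limitSets_subset_limitSets_of_tendsto fun P hP => ?_)
    (limitSets_subset_limitSets_of_tendsto key)
  simpa only [hausdorffEDist_comm] using key P hP
end

section
/- Let X be a separable real Banach space and let F : [0,1] → 2^X \ {∅} be a compact-valued bounded multifunction. Then I(F) is star-shaped: there exists A_0 ∈ I(F) such that for every A ∈ I(F) and every λ ∈ [0,1], the set λA_0 + (1−λ)A belongs to I(F). In particular, I(F) is nonempty. -/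
open Pointwise Filter Metric Set

open MeasureTheory TopologicalSpace

section SupportFunction

variable {X : Type*} [NormedAddCommGroup X] [NormedSpace ℝ X]

/-- Every point of `A` lies within distance `r` of some point of `B`. -/
def NearBy (r : ℝ) (A B : Set X) : Prop := ∀ x ∈ A, ∃ y ∈ B, ‖x - y‖ ≤ r

omit [NormedSpace ℝ X] in
theorem NearBy.mono {r r' : ℝ} {A B : Set X} (h : NearBy r A B) (hr : r ≤ r') : NearBy r' A B :=
  fun x hx => let ⟨y, hy, hxy⟩ := h x hx; ⟨y, hy, hxy.trans hr⟩

omit [NormedSpace ℝ X] in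
theorem NearBy.trans {r r' : ℝ} {A B C : Set X} (h : NearBy r A B) (h' : NearBy r' B C) :
    NearBy (r + r') A C := by
  intro x hx
  obtain ⟨y, hy, hxy⟩ := h x hx
  obtain ⟨z, hz, hyz⟩ := h' y hy
  refine ⟨z, hz, ?_⟩
  calc ‖x - z‖ = ‖(x - y) + (y - z)‖ := by congr 1; abel
    _ ≤ _ := (norm_add_le _ _).trans (add_le_add hxy hyz)

omit [NormedSpace ℝ X] in
theorem NearBy.add {r r' : ℝ} {A B A' B' : Set X} (h : NearBy r A B) (h' : NearBy r' A' B') :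
    NearBy (r + r') (A + A') (B + B') := by
  rintro _ ⟨x, hx, x', hx', rfl⟩
  obtain ⟨y, hy, hxy⟩ := h x hx
  obtain ⟨y', hy', hxy'⟩ := h' x' hx'
  refine ⟨y + y', Set.add_mem_add hy hy', ?_⟩
  calc ‖x + x' - (y + y')‖ = ‖(x - y) + (x' - y')‖ := by congr 1; abel
    _ ≤ _ := (norm_add_le _ _).trans (add_le_add hxy hxy')

theorem NearBy.smul {r c : ℝ} {A B : Set X} (h : NearBy r A B) (hc : 0 ≤ c) :
    NearBy (c * r) (c • A) (c • B) := by
  rintro _ ⟨x, hx, rfl⟩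
  obtain ⟨y, hy, hxy⟩ := h x hx
  refine ⟨c • y, Set.smul_mem_smul_set hy, ?_⟩
  simp only [← smul_sub, norm_smul, Real.norm_of_nonneg hc]
  exact mul_le_mul_of_nonneg_left hxy hc

theorem NearBy.convexHull_left {r : ℝ} {A B : Set X} (h : NearBy r A B) (hB : Convex ℝ B) :
    NearBy r (convexHull ℝ A) B := by
  have hconv : Convex ℝ (B + Metric.closedBall (0 : X) r) := hB.add (convex_closedBall _ _)
  have hsub : A ⊆ B + Metric.closedBall (0 : X) r := by
    intro x hx
    obtain ⟨y, hy, hxy⟩ := h x hx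
    exact ⟨y, hy, x - y, by simpa using hxy, by simp⟩
  intro x hx
  obtain ⟨y, hy, z, hz, rfl⟩ := convexHull_min hsub hconv hx
  exact ⟨y, hy, by simpa using hz⟩

omit [NormedSpace ℝ X] in
theorem hausdorffEDist_le_of_nearBy {r : ℝ} {A B : Set X} (h : NearBy r A B) (h' : NearBy r B A) :
    Metric.hausdorffEDist A B ≤ ENNReal.ofReal r := by
  refine Metric.hausdorffEDist_le_of_mem_edist (fun x hx => ?_) (fun x hx => ?_)
  · obtain ⟨y, hy, hxy⟩ := h x hx
    exact ⟨y, hy, by rw [edist_dist, dist_eq_norm]; exact ENNReal.ofReal_le_ofReal hxy⟩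
  · obtain ⟨y, hy, hxy⟩ := h' x hx
    exact ⟨y, hy, by rw [edist_dist, dist_eq_norm]; exact ENNReal.ofReal_le_ofReal hxy⟩

omit [NormedSpace ℝ X] in
theorem nearBy_of_hausdorffEDist_lt {r : ℝ} {A B : Set X}
    (h : Metric.hausdorffEDist A B < ENNReal.ofReal r) : NearBy r A B := by
  intro x hx
  obtain ⟨y, hy, hxy⟩ := Metric.exists_edist_lt_of_hausdorffEDist_lt hx h
  refine ⟨y, hy, ?_⟩
  rw [edist_dist, dist_eq_norm, ENNReal.ofReal_lt_ofReal_iff_of_nonneg (norm_nonneg _)] at hxy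
  exact hxy.le

/-- The support function of a set. -/
noncomputable def suppFun (K : Set X) (φ : StrongDual ℝ X) : ℝ := sSup (φ '' K)

theorem suppFun_eq {K : Set X} {φ : StrongDual ℝ X} {x : X} (hx : x ∈ K)
    (h : ∀ y ∈ K, φ y ≤ φ x) : suppFun K φ = φ x :=
  IsGreatest.csSup_eq ⟨Set.mem_image_of_mem _ hx, by rintro _ ⟨y, hy, rfl⟩; exact h y hy⟩

theorem exists_suppFun_eq {K : Set X} (hK : IsCompact K) (hne : K.Nonempty)
    (φ : StrongDual ℝ X) : ∃ x ∈ K, suppFun K φ = φ x ∧ ∀ y ∈ K, φ y ≤ φ x := by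
  obtain ⟨x, hx, h⟩ := hK.exists_isMaxOn hne φ.continuous.continuousOn
  exact ⟨x, hx, suppFun_eq hx h, h⟩

theorem suppFun_add {K L : Set X} (hK : IsCompact K) (hKne : K.Nonempty) (hL : IsCompact L)
    (hLne : L.Nonempty) (φ : StrongDual ℝ X) :
    suppFun (K + L) φ = suppFun K φ + suppFun L φ := by
  obtain ⟨x, hx, h1, h2⟩ := exists_suppFun_eq hK hKne φ
  obtain ⟨y, hy, h3, h4⟩ := exists_suppFun_eq hL hLne φ
  rw [h1, h3, ← map_add]
  refine suppFun_eq (Set.add_mem_add hx hy) ?_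
  rintro _ ⟨a, ha, b, hb, rfl⟩
  simp only [map_add]
  exact add_le_add (h2 a ha) (h4 b hb)

theorem suppFun_smul {K : Set X} (hK : IsCompact K) (hKne : K.Nonempty) {c : ℝ} (hc : 0 ≤ c)
    (φ : StrongDual ℝ X) : suppFun (c • K) φ = c * suppFun K φ := by
  obtain ⟨x, hx, h1, h2⟩ := exists_suppFun_eq hK hKne φ
  have : c * φ x = φ (c • x) := by simp
  rw [h1, this]
  refine suppFun_eq (Set.smul_mem_smul_set hx) ?_
  rintro _ ⟨a, ha, rfl⟩
  simp only [map_smul, smul_eq_mul]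
  exact mul_le_mul_of_nonneg_left (h2 a ha) hc

theorem suppFun_convexHull {K : Set X} (hK : IsCompact K) (hKne : K.Nonempty)
    (φ : StrongDual ℝ X) : suppFun (convexHull ℝ K) φ = suppFun K φ := by
  obtain ⟨x, hx, h1, h2⟩ := exists_suppFun_eq hK hKne φ
  rw [h1]
  refine suppFun_eq (subset_convexHull ℝ K hx) fun y hy => ?_
  exact convexHull_min (t := {y | φ y ≤ φ x}) h2
    (convex_halfSpace_le (IsLinearMap.mk φ.map_add φ.map_smul) _) hy

theorem suppFun_closure_convexHull {K : Set X} (hK : IsCompact K) (hKne : K.Nonempty)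
    (φ : StrongDual ℝ X) : suppFun (closure (convexHull ℝ K)) φ = suppFun K φ := by
  obtain ⟨x, hx, h1, h2⟩ := exists_suppFun_eq hK hKne φ
  rw [h1]
  refine suppFun_eq (subset_closure (subset_convexHull ℝ K hx)) fun y hy => ?_
  refine closure_minimal (t := {y | φ y ≤ φ x}) (convexHull_min h2
    (convex_halfSpace_le (IsLinearMap.mk φ.map_add φ.map_smul) _)) ?_ hy
  exact isClosed_le φ.continuous continuous_const

theorem suppFun_le_of_nearBy {K L : Set X} (hK : IsCompact K) (hKne : K.Nonempty)
    (hL : IsCompact L) (hLne : L.Nonempty) {r : ℝ} (h : NearBy r K L) {φ : StrongDual ℝ X}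
    (hφ : ‖φ‖ ≤ 1) : suppFun K φ ≤ suppFun L φ + r := by
  obtain ⟨x, hx, h1, h2⟩ := exists_suppFun_eq hK hKne φ
  obtain ⟨y, hy, h3, h4⟩ := exists_suppFun_eq hL hLne φ
  obtain ⟨z, hz, hxz⟩ := h x hx
  have : φ (x - z) ≤ r := (le_abs_self _).trans ((φ.le_of_opNorm_le hφ _).trans (by simpa using hxz))
  rw [map_sub] at this
  linarith [h4 z hz]

theorem abs_suppFun_le {K : Set X} (hK : IsCompact K) (hKne : K.Nonempty) {M : ℝ}
    (hM : ∀ x ∈ K, ‖x‖ ≤ M) {φ : StrongDual ℝ X} (hφ : ‖φ‖ ≤ 1) : |suppFun K φ| ≤ M := by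
  obtain ⟨x, hx, h1, -⟩ := exists_suppFun_eq hK hKne φ
  rw [h1]
  exact (φ.le_of_opNorm_le hφ _).trans (by simpa using hM x hx)

/-- A comparison of support functions yields, by Hahn–Banach separation, a comparison of sets. -/
theorem nearBy_of_suppFun_le {K L : Set X} (hK : Convex ℝ K) (hKne : K.Nonempty)
    (hL : IsCompact L) {r r' : ℝ} (hr : r < r') (hr0 : 0 ≤ r)
    (h : ∀ φ : StrongDual ℝ X, ‖φ‖ ≤ 1 → suppFun L φ ≤ suppFun K φ + r) : NearBy r' L K := by
  intro x hx
  by_contra! hcon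
  have hdisj : Disjoint (Metric.ball x r') K := by
    rw [Set.disjoint_left]
    intro y hy hyK
    have := hcon y hyK
    rw [mem_ball, dist_comm, dist_eq_norm] at hy
    linarith
  obtain ⟨f, u, hf1, hf2⟩ := geometric_hahn_banach_open (convex_ball x r') isOpen_ball hK hdisj
  have hr'0 : 0 < r' := hr0.trans_lt hr
  have hf0 : 0 < ‖f‖ := by
    rw [norm_pos_iff]
    rintro rfl
    obtain ⟨k, hk⟩ := hKne
    have h1 := hf1 x (mem_ball_self hr'0)
    have h2 := hf2 k hk
    simp at h1 h2
    linarith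
  obtain ⟨v, hv1, hv2⟩ := f.exists_lt_apply_of_lt_opNorm
    (show r / r' * ‖f‖ < ‖f‖ from mul_lt_of_lt_one_left hf0 ((div_lt_one hr'0).2 hr))
  have key : f x + r * ‖f‖ < u := by
    have habs : r * ‖f‖ < |f (r' • v)| := by
      rw [map_smul, smul_eq_mul, abs_mul, abs_of_pos hr'0]
      calc r * ‖f‖ = r' * (r / r' * ‖f‖) := by field_simp
        _ < _ := by gcongr; exact hv2
    have hnorm : ‖r' • v‖ < r' := by
      rw [norm_smul, Real.norm_of_nonneg hr'0.le]
      exact mul_lt_of_lt_one_right hr'0 hv1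
    have h1 := hf1 (x + r' • v) (by simpa [mem_ball, dist_eq_norm] using hnorm)
    have h2 := hf1 (x - r' • v) (by
      rw [mem_ball, dist_eq_norm, sub_sub_cancel_left, norm_neg]; exact hnorm)
    rw [map_add] at h1
    rw [map_sub] at h2
    rcases abs_cases (f (r' • v)) with hc | hc <;> linarith
  have hψ : ‖-(‖f‖⁻¹ • f)‖ ≤ 1 := by
    rw [norm_neg, norm_smul, norm_inv, norm_norm, inv_mul_cancel₀ hf0.ne']
  have hle := h _ hψ
  have hKle : suppFun K (-(‖f‖⁻¹ • f)) ≤ -(‖f‖⁻¹ * u) := by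
    refine csSup_le (hKne.image _) ?_
    rintro _ ⟨k, hk, rfl⟩
    simp only [neg_apply, smul_apply, smul_eq_mul,
      neg_le_neg_iff]
    exact mul_le_mul_of_nonneg_left (hf2 k hk) (by positivity)
  have hLge : -(‖f‖⁻¹ * f x) ≤ suppFun L (-(‖f‖⁻¹ • f)) := by
    refine le_csSup (hL.image (ContinuousLinearMap.continuous _)).bddAbove ⟨x, hx, ?_⟩
    simp
  have : ‖f‖⁻¹ * (f x + r * ‖f‖) < ‖f‖⁻¹ * u := by gcongr
  rw [mul_add, mul_comm r, inv_mul_cancel_left₀ hf0.ne'] at this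
  linarith

end SupportFunction

section Averaging

variable {X : Type*} [NormedAddCommGroup X] [NormedSpace ℝ X]

/-- Sums of many copies of a finite set fill the corresponding multiple of its convex hull up to
a bounded error. -/
theorem exists_norm_card_smul_sub_sum_le {S : Set X} (hS : S.Finite) (ι : Type*) :
    ∃ K : ℝ, ∀ s : Finset ι, ∀ x ∈ convexHull ℝ S,
      ∃ y : ι → X, (∀ i ∈ s, y i ∈ S) ∧ ‖(s.card : ℝ) • x - ∑ i ∈ s, y i‖ ≤ K := by
  classical
  induction S, hS using Set.Finite.induction_on with
  | empty => exact ⟨0, fun s x hx => by simp at hx⟩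
  | @insert a S _ _ ih =>
    obtain ⟨K, hK⟩ := ih
    rcases S.eq_empty_or_nonempty with rfl | hne
    · refine ⟨0, fun s x hx => ⟨fun _ => a, by simp, ?_⟩⟩
      simp only [insert_empty_eq, convexHull_singleton, mem_singleton_iff] at hx
      subst hx
      simp [Nat.cast_smul_eq_nsmul]
    obtain ⟨M, hM⟩ : ∃ M, ∀ z ∈ convexHull ℝ S, ‖z‖ ≤ M := by
      have : Bornology.IsBounded (convexHull ℝ S) :=
        isBounded_convexHull.2 (Set.Finite.isBounded ‹_›)
      exact this.exists_norm_le
    refine ⟨‖a‖ + M + K, fun s x hx => ?_⟩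
    rw [convexHull_insert hne, mem_convexJoin] at hx
    obtain ⟨a', ha', z, hz, hx⟩ := hx
    obtain rfl : a' = a := ha'
    obtain ⟨α, β, hα, hβ, hαβ, rfl⟩ := hx
    set N := s.card
    set n := ⌊(N : ℝ) * α⌋₊ with hn
    have hnle : (n : ℝ) ≤ N * α := Nat.floor_le (by positivity)
    have hnlt : (N : ℝ) * α < n + 1 := Nat.lt_floor_add_one _
    have hnN : n ≤ N := by
      have : (n : ℝ) ≤ N := hnle.trans (mul_le_of_le_one_right (by positivity) (by linarith))
      exact_mod_cast this
    obtain ⟨t, hts, htc⟩ := Finset.exists_subset_card_eq hnN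
    obtain ⟨y, hy, hyK⟩ := hK (s \ t) z hz
    have hcard : ((s \ t).card : ℝ) = N - n := by
      rw [Finset.card_sdiff_of_subset hts, htc, Nat.cast_sub hnN]
    rw [hcard] at hyK
    refine ⟨fun i => if i ∈ t then a' else y i, fun i hi => ?_, ?_⟩
    · by_cases hit : i ∈ t
      · simp [hit]
      · simpa [hit] using Or.inr (hy i (by simp [hi, hit]))
    have hsum : ∑ i ∈ s, (if i ∈ t then a' else y i) = (n : ℝ) • a' + ∑ i ∈ s \ t, y i := by
      rw [← Finset.sum_sdiff hts, add_comm]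
      congr 1
      · rw [Finset.sum_congr rfl (g := fun _ => a') (fun i hi => by simp [hi]), Finset.sum_const,
          htc, Nat.cast_smul_eq_nsmul]
      · exact Finset.sum_congr rfl fun i hi => by simp [(Finset.mem_sdiff.1 hi).2]
    rw [hsum]
    have hβ' : β = 1 - α := by linarith
    calc ‖(N : ℝ) • (α • a' + β • z) - ((n : ℝ) • a' + ∑ i ∈ s \ t, y i)‖
        = ‖((N : ℝ) * α - n) • a' + (n - (N : ℝ) * α) • z
            + (((N : ℝ) - n) • z - ∑ i ∈ s \ t, y i)‖ := by
          congr 1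
          rw [hβ']
          module
      _ ≤ ‖((N : ℝ) * α - n) • a'‖ + ‖(n - (N : ℝ) * α) • z‖ + K :=
          (norm_add_le _ _).trans (add_le_add (norm_add_le _ _) hyK)
      _ ≤ 1 * ‖a'‖ + 1 * M + K := by
          rw [norm_smul, norm_smul]
          have h1 : ‖(N : ℝ) * α - n‖ ≤ 1 := by rw [Real.norm_eq_abs, abs_le]; constructor <;> linarith
          have h2 : ‖(n : ℝ) - N * α‖ ≤ 1 := by rw [norm_sub_rev]; exact h1
          gcongr
          exact hM z hz
      _ = _ := by ring

/-- Sums of many sets close to a fixed compact set are almost convex. -/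
theorem exists_norm_sum_sub_sum_le_of_nearBy {Y : Set X} (hY : IsCompact Y) {ε : ℝ} (hε : 0 < ε)
    (ι : Type*) :
    ∃ K : ℝ, ∀ (s : Finset ι) (C : ι → Set X),
      (∀ i ∈ s, NearBy ε (C i) Y ∧ NearBy ε Y (C i)) →
      ∀ x : ι → X, (∀ i ∈ s, x i ∈ convexHull ℝ (C i)) →
      ∃ y : ι → X, (∀ i ∈ s, y i ∈ C i) ∧ ‖∑ i ∈ s, (x i - y i)‖ ≤ 3 * ε * s.card + K := by
  obtain ⟨S, hSY, hSfin, hcov⟩ := hY.finite_cover_balls hε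
  obtain ⟨K, hK⟩ := exists_norm_card_smul_sub_sum_le hSfin ι
  refine ⟨max K 0, fun s C hC x hx => ?_⟩
  rcases s.eq_empty_or_nonempty with rfl | hsne
  · exact ⟨x, by simp, by simp⟩
  have hYS : NearBy ε Y S := by
    intro y hy
    obtain ⟨z, hz, hyz⟩ := Set.mem_iUnion₂.1 (hcov hy)
    rw [Metric.mem_ball, dist_eq_norm] at hyz
    exact ⟨z, hz, hyz.le⟩
  have h1 : ∀ i, ∃ x', i ∈ s → x' ∈ convexHull ℝ S ∧ ‖x i - x'‖ ≤ ε + ε := by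
    intro i
    by_cases hi : i ∈ s
    · have : NearBy (ε + ε) (C i) (convexHull ℝ S) := by
        intro c hc
        obtain ⟨z, hz, hcz⟩ := ((hC i hi).1.trans hYS) c hc
        exact ⟨z, subset_convexHull ℝ S hz, hcz⟩
      obtain ⟨x', hx'⟩ := this.convexHull_left (convex_convexHull ℝ S) _ (hx i hi)
      exact ⟨x', fun _ => hx'⟩
    · exact ⟨0, fun h => absurd h hi⟩
  choose x' hx' using h1
  have hcard : (0 : ℝ) < s.card := by exact_mod_cast hsne.card_pos
  have hmean : (s.card : ℝ)⁻¹ • ∑ i ∈ s, x' i ∈ convexHull ℝ S := by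
    rw [Finset.smul_sum]
    refine (convex_convexHull ℝ S).sum_mem (fun i _ => by positivity) ?_ fun i hi => (hx' i hi).1
    rw [Finset.sum_const, nsmul_eq_mul, mul_inv_cancel₀ hcard.ne']
  obtain ⟨y', hy', hy'K⟩ := hK s _ hmean
  rw [smul_smul, mul_inv_cancel₀ hcard.ne', one_smul] at hy'K
  have h2 : ∀ i, ∃ y, i ∈ s → y ∈ C i ∧ ‖y' i - y‖ ≤ ε := by
    intro i
    by_cases hi : i ∈ s
    · obtain ⟨y, hy⟩ := (hC i hi).2 (y' i) (hSY (hy' i hi))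
      exact ⟨y, fun _ => hy⟩
    · exact ⟨0, fun h => absurd h hi⟩
  choose y hy using h2
  refine ⟨y, fun i hi => (hy i hi).1, ?_⟩
  calc ‖∑ i ∈ s, (x i - y i)‖
      = ‖∑ i ∈ s, (x i - x' i) + (∑ i ∈ s, x' i - ∑ i ∈ s, y' i) + ∑ i ∈ s, (y' i - y i)‖ := by
        congr 1
        simp only [Finset.sum_sub_distrib]
        abel
    _ ≤ s.card * (ε + ε) + K + s.card * ε := by
        refine (norm_add₃_le).trans (add_le_add (add_le_add ?_ hy'K) ?_)
        · refine (norm_sum_le_of_le s fun i hi => (hx' i hi).2).trans ?_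
          simp [mul_add]
        · refine (norm_sum_le_of_le s fun i hi => (hy i hi).2).trans ?_
          simp
    _ ≤ _ := by linarith [le_max_left K 0]

/-- A sum of many sets, most of which are close to members of a finite family of compact sets,
is almost convex. -/
theorem exists_nearBy_convexHull_sum {m : ℕ} {Y : ℕ → Set X} (hY : ∀ j, IsCompact (Y j)) {ε M : ℝ}
    (hε : 0 < ε) :
    ∃ K : ℝ, ∀ (s b : Finset ℕ) (C : ℕ → Set X) (h : ℝ), b ⊆ s → 0 ≤ h →
      (∀ i ∈ s, ∀ x ∈ C i, ‖x‖ ≤ M) → (∀ i ∈ s, (C i).Nonempty) →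
      (∀ i ∈ s \ b, ∃ j < m, NearBy ε (C i) (Y j) ∧ NearBy ε (Y j) (C i)) →
      NearBy (h * (3 * ε * s.card + K + 2 * M * b.card))
        (convexHull ℝ (∑ i ∈ s, h • C i)) (∑ i ∈ s, h • C i) := by
  classical
  choose K hK using fun j => exists_norm_sum_sub_sum_le_of_nearBy (hY j) hε ℕ
  refine ⟨∑ j ∈ Finset.range m, K j, fun s b C h hbs hh hM hne hC x hx => ?_⟩
  simp only [convexHull_sum, convexHull_smul] at hx
  obtain ⟨f, hf, rfl⟩ := (Set.mem_finsetSum _ _ _).1 hx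
  have h1 : ∀ i, ∃ z, i ∈ s → z ∈ convexHull ℝ (C i) ∧ h • z = f i := by
    intro i
    by_cases hi : i ∈ s
    · obtain ⟨z, hz, hzf⟩ := hf hi
      exact ⟨z, fun _ => ⟨hz, hzf⟩⟩
    · exact ⟨0, fun h => absurd h hi⟩
  choose z hz using h1
  have h2 : ∀ i, ∃ j, i ∈ s \ b → j < m ∧ NearBy ε (C i) (Y j) ∧ NearBy ε (Y j) (C i) := by
    intro i
    by_cases hi : i ∈ s \ b
    · obtain ⟨j, hj⟩ := hC i hi
      exact ⟨j, fun _ => hj⟩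
    · exact ⟨0, fun h => absurd h hi⟩
  choose c hc using h2
  have h3 : ∀ j, ∃ y : ℕ → X, (∀ i ∈ (s \ b).filter (c · = j), y i ∈ C i) ∧
      ‖∑ i ∈ (s \ b).filter (c · = j), (z i - y i)‖ ≤
        3 * ε * ((s \ b).filter (c · = j)).card + K j := by
    intro j
    refine hK j _ C (fun i hi => ?_) z fun i hi => ?_
    · obtain ⟨hi', rfl⟩ := Finset.mem_filter.1 hi
      exact (hc i hi').2
    · exact (hz i (Finset.mem_sdiff.1 (Finset.mem_filter.1 hi).1).1).1
  choose y hy hyK using h3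
  have h4 : ∀ i, ∃ y, i ∈ s → y ∈ C i := by
    intro i
    by_cases hi : i ∈ s
    · obtain ⟨w, hw⟩ := hne i hi
      exact ⟨w, fun _ => hw⟩
    · exact ⟨0, fun h => absurd h hi⟩
  choose y₀ hy₀ using h4
  let v : ℕ → X := fun i => if i ∈ b then y₀ i else y (c i) i
  have hv : ∀ i ∈ s, v i ∈ C i := by
    intro i hi
    by_cases hib : i ∈ b
    · simpa [v, hib] using hy₀ i hi
    · simp only [v, hib, if_false]
      exact hy _ i (Finset.mem_filter.2 ⟨Finset.mem_sdiff.2 ⟨hi, hib⟩, rfl⟩)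
  refine ⟨∑ i ∈ s, h • v i, (Set.mem_finsetSum _ _ _).2
    ⟨fun i => h • v i, fun hi => Set.smul_mem_smul_set (hv _ hi), rfl⟩, ?_⟩
  have hfac : ∑ i ∈ s, f i - ∑ i ∈ s, h • v i = h • ∑ i ∈ s, (z i - v i) := by
    rw [Finset.smul_sum, ← Finset.sum_sub_distrib]
    exact Finset.sum_congr rfl fun i hi => by rw [smul_sub, (hz i hi).2]
  rw [hfac, norm_smul, Real.norm_of_nonneg hh]
  refine mul_le_mul_of_nonneg_left ?_ hh
  rw [← Finset.sum_sdiff hbs]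
  refine (norm_add_le _ _).trans (add_le_add ?_ ?_)
  · rw [← Finset.sum_fiberwise_of_maps_to (t := Finset.range m) (g := c)
      (fun i hi => Finset.mem_range.2 (hc i hi).1)]
    refine (norm_sum_le_of_le _ fun j _ => ?_).trans (b := ∑ j ∈ Finset.range m,
      (3 * ε * ((s \ b).filter (c · = j)).card + K j)) ?_
    · refine le_trans (le_of_eq ?_) (hyK j)
      congr 1
      refine Finset.sum_congr rfl fun i hi => ?_
      obtain ⟨hi', rfl⟩ := Finset.mem_filter.1 hi
      simp [v, (Finset.mem_sdiff.1 hi').2]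
    · rw [Finset.sum_add_distrib, ← Finset.mul_sum]
      gcongr
      rw [← Nat.cast_sum, ← Finset.card_eq_sum_card_fiberwise
        (fun i hi => Finset.mem_coe.2 (Finset.mem_range.2 (hc i hi).1))]
      exact_mod_cast Finset.card_le_card Finset.sdiff_subset
  · refine (norm_sum_le_of_le b (f := fun i => z i - v i) (n := fun _ => 2 * M)
      fun i hi => ?_).trans (by simp [mul_comm])
    have hzM : ‖z i‖ ≤ M := by
      have := convexHull_min (s := C i) (t := Metric.closedBall 0 M)
        (fun x hx => by simpa using hM i (hbs hi) x hx) (convex_closedBall _ _)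
        (hz i (hbs hi)).1
      simpa using this
    exact (norm_sub_le _ _).trans (by linarith [hM i (hbs hi) _ (hv i (hbs hi))])

end Averaging

section Thick

/-- A set of reals is thick if it meets every measurable set of positive measure, i.e. if it has
full outer measure. -/
def IsThick (Z : Set ℝ) : Prop := ∀ B, MeasurableSet B → Disjoint B Z → volume B = 0

theorem IsThick.inter_nonempty {Z B : Set ℝ} (hZ : IsThick Z) (hB : MeasurableSet B)
    (h : volume B ≠ 0) : (B ∩ Z).Nonempty := by
  by_contra hne
  exact h (hZ B hB (Set.disjoint_iff_inter_eq_empty.2 (Set.not_nonempty_iff_eq_empty.1 hne)))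

theorem isThick_univ : IsThick Set.univ := fun B _ h => by
  rw [Set.disjoint_univ] at h
  simp [h]

theorem IsThick.inter_ae {Z : Set ℝ} (hZ : IsThick Z) {p : ℝ → Prop}
    (hp : ∀ᵐ t ∂volume, p t) : IsThick (Z ∩ {t | p t}) := by
  intro B hB hdisj
  have hN : volume {t | ¬ p t} = 0 := hp
  have h1 : volume (B \ toMeasurable volume {t | ¬ p t}) = 0 := by
    refine hZ _ (hB.diff (measurableSet_toMeasurable _ _)) ?_
    rw [Set.disjoint_left] at hdisj ⊢
    rintro t ⟨htB, htN⟩ htZ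
    by_cases hpt : p t
    · exact hdisj htB ⟨htZ, hpt⟩
    · exact htN (subset_toMeasurable _ _ hpt)
  rw [← measure_toMeasurable] at hN
  exact measure_mono_null (fun t ht => by
    by_cases h : t ∈ toMeasurable volume {t | ¬ p t}
    · exact Or.inr h
    · exact Or.inl ⟨ht, h⟩) (measure_union_null h1 hN)

theorem IsThick.ae_of_forall {Z : Set ℝ} (hZ : IsThick Z) {p : ℝ → Prop}
    (hp : MeasurableSet {t | p t}) (h : ∀ t ∈ Z, p t) : ∀ᵐ t ∂volume, p t :=
  hZ _ hp.compl (Set.disjoint_left.2 fun t ht htZ => ht (h t htZ))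

variable {Y : Type*} [MetricSpace Y] [SeparableSpace Y] [Nonempty Y] [MeasurableSpace Y]

/-- Any function into a separable space is uniformly close, on a thick set, to a measurable one. -/
theorem IsThick.exists_measurable_dist_lt {Z : Set ℝ} (hZ : IsThick Z) (f : ℝ → Y) {ε : ℝ}
    (hε : 0 < ε) : ∃ Z' ⊆ Z, IsThick Z' ∧ ∃ ψ : ℝ → Y, Measurable ψ ∧
      ∀ t ∈ Z', dist (f t) (ψ t) < ε := by
  let E : ℕ → Set ℝ := fun k => Z ∩ {t | dist (f t) (denseSeq Y k) < ε}
  let D : ℕ → Set ℝ := disjointed fun k => toMeasurable volume (E k)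
  have hD : ∀ k, MeasurableSet (D k) :=
    MeasurableSet.disjointed fun k => measurableSet_toMeasurable _ _
  have hdisj : Pairwise (Function.onFun Disjoint D) := disjoint_disjointed _
  have hDU : ⋃ k, D k = ⋃ k, toMeasurable volume (E k) := iUnion_disjointed
  obtain ⟨ψ, hψ, hψD⟩ := exists_measurable_piecewise D hD (fun k _ => denseSeq Y k)
    (fun k => measurable_const) (by
      intro i j hij t ht
      exact absurd ht.2 (Set.disjoint_left.1 (hdisj hij) ht.1))
  refine ⟨⋃ k, D k ∩ E k, Set.iUnion_subset fun k t ht => ht.2.1, ?_, ψ, hψ, ?_⟩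
  · intro B hB hBd
    have hcover : Z ⊆ ⋃ k, D k := by
      intro t ht
      rw [hDU]
      obtain ⟨k, hk⟩ := (denseRange_denseSeq Y).exists_dist_lt (f t) hε
      exact Set.mem_iUnion.2 ⟨k, subset_toMeasurable _ _ ⟨ht, hk⟩⟩
    have h0 : volume (B \ ⋃ k, D k) = 0 :=
      hZ _ (hB.diff (MeasurableSet.iUnion hD)) (Set.disjoint_left.2 fun t ht htZ =>
        ht.2 (hcover htZ))
    have h1 : ∀ k, volume (B ∩ D k) = 0 := by
      intro k
      have hsub : D k ⊆ toMeasurable volume (E k) := disjointed_subset _ k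
      have := Measure.measure_toMeasurable_inter_of_sFinite (μ := volume) (hB.inter (hD k)) (E k)
      rw [Set.inter_eq_right.2 (Set.inter_subset_right.trans hsub)] at this
      rw [this]
      convert measure_empty (μ := (volume : Measure ℝ))
      rw [Set.eq_empty_iff_forall_notMem]
      rintro t ⟨htE, htB, htD⟩
      exact Set.disjoint_left.1 hBd htB (Set.mem_iUnion.2 ⟨k, htD, htE⟩)
    refine measure_mono_null (t := (B \ ⋃ k, D k) ∪ ⋃ k, B ∩ D k) ?_
      (measure_union_null h0 (measure_iUnion_null h1))
    rw [← Set.inter_iUnion, Set.sdiff_union_inter]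
  · intro t ht
    obtain ⟨k, htD, htE⟩ := Set.mem_iUnion.1 ht
    rw [hψD k htD]
    exact htE.2

/-- For every function `f` into a complete separable metric space there is a measurable function
that is uniformly close to `f` on thick sets, to any prescribed precision. -/
theorem exists_measurable_forall_isThick_dist_lt [CompleteSpace Y] [BorelSpace Y] (f : ℝ → Y) :
    ∃ g : ℝ → Y, Measurable g ∧
      ∀ ε > 0, ∃ Z, IsThick Z ∧ ∀ t ∈ Z, dist (f t) (g t) < ε := by
  have hstep : ∀ (n : ℕ) (Z : {Z : Set ℝ // IsThick Z}), ∃ Z' : {Z : Set ℝ // IsThick Z},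
      Z'.1 ⊆ Z.1 ∧ ∃ ψ : ℝ → Y, Measurable ψ ∧ ∀ t ∈ Z'.1, dist (f t) (ψ t) < 1 / 4 / 2 ^ n := by
    intro n Z
    obtain ⟨Z', h1, h2, h3⟩ :=
      Z.2.exists_measurable_dist_lt f (ε := 1 / 4 / 2 ^ n) (by positivity)
    exact ⟨⟨Z', h2⟩, h1, h3⟩
  choose next hsub ψ hψ hdist using hstep
  let Z : ℕ → {Z : Set ℝ // IsThick Z} := fun n =>
    Nat.rec ⟨Set.univ, isThick_univ⟩ (fun n Z => next n Z) n
  let u : ℕ → ℝ → Y := fun n => ψ n (Z n)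
  have hu : ∀ n, Measurable (u n) := fun n => hψ n (Z n)
  have hZsub : ∀ n, (Z (n + 1)).1 ⊆ (Z n).1 := fun n => hsub n (Z n)
  have hZu : ∀ n, ∀ t ∈ (Z (n + 1)).1, dist (f t) (u n t) < 1 / 4 / 2 ^ n :=
    fun n => hdist n (Z n)
  have hae : ∀ᵐ t ∂volume, ∀ n, dist (u n t) (u (n + 1) t) ≤ 1 / 2 / 2 ^ n := by
    rw [ae_all_iff]
    intro n
    refine (Z (n + 2)).2.ae_of_forall
      (measurableSet_le ((hu n).dist (hu (n + 1))) measurable_const) fun t ht => ?_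
    have h1 := hZu n t (hZsub (n + 1) ht)
    have h2 := hZu (n + 1) t ht
    have h3 := dist_triangle_left (u n t) (u (n + 1) t) (f t)
    have h4 : (1 : ℝ) / 4 / 2 ^ (n + 1) ≤ 1 / 4 / 2 ^ n := by
      gcongr <;> norm_num
    have h5 : (1 : ℝ) / 2 / 2 ^ n = 1 / 4 / 2 ^ n + 1 / 4 / 2 ^ n := by ring
    linarith
  obtain ⟨g, hg, hlim⟩ := measurable_limit_of_tendsto_metrizable_ae (L := atTop)
    (fun n => (hu n).aemeasurable) (by
      filter_upwards [hae] with t ht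
      exact cauchySeq_tendsto_of_complete (cauchySeq_of_le_geometric_two ht))
  refine ⟨g, hg, fun ε hε => ?_⟩
  obtain ⟨n, hn⟩ := exists_pow_lt_of_lt_one (show 0 < ε / 2 by positivity)
    (show (1 / 2 : ℝ) < 1 by norm_num)
  refine ⟨_, (Z (n + 1)).2.inter_ae (hae.and hlim), ?_⟩
  rintro t ⟨htZ, ht1, ht2⟩
  have h1 := hZu n t htZ
  have h2 := dist_le_of_le_geometric_two_of_tendsto ht1 ht2 n
  have h3 : (1 : ℝ) / 2 ^ n = (1 / 2) ^ n := by simp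
  have h4 : (1 : ℝ) / 4 / 2 ^ n ≤ (1 / 2) ^ n := by
    rw [div_div, mul_comm, ← div_div, h3]
    exact div_le_self (by positivity) (by norm_num)
  have h5 := dist_triangle (f t) (u n t) (g t)
  linarith

end Thick

section RiemannSums

variable {X : Type*} [NormedAddCommGroup X] [NormedSpace ℝ X]

/-- `RiemannSumOn F η a b S` says that `S` is a Riemann sum of `F` over `[a, b]` for a tagged
partition of diameter at most `η`. -/
inductive RiemannSumOn (F : ℝ → Set X) (η : ℝ) : ℝ → ℝ → Set X → Prop
  | refl (a : ℝ) : RiemannSumOn F η a a 0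
  | snoc {a b c ξ : ℝ} {S : Set X} : RiemannSumOn F η a b S → ξ ∈ Set.Icc b c → c - b ≤ η →
      RiemannSumOn F η a c (S + (c - b) • F ξ)

theorem RiemannSumOn.append {F : ℝ → Set X} {η a b c : ℝ} {S T : Set X}
    (h : RiemannSumOn F η a b S) (h' : RiemannSumOn F η b c T) :
    RiemannSumOn F η a c (S + T) := by
  induction h' with
  | refl => simpa using h
  | snoc _ hξ hη ih => rw [← add_assoc]; exact ih.snoc hξ hη

theorem RiemannSumOn.equal {F : ℝ → Set X} {η a d : ℝ} (hd : d ≤ η) {t : ℕ → ℝ} {N : ℕ}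
    (ht : ∀ i < N, t i ∈ Set.Icc (a + i * d) (a + (i + 1) * d)) :
    RiemannSumOn F η a (a + N * d) (∑ i ∈ Finset.range N, d • F (t i)) := by
  induction N with
  | zero => simpa using RiemannSumOn.refl a
  | succ N ih =>
    have h := (ih fun i hi => ht i (by omega)).snoc (ht N (by omega)) (by linarith)
    rw [Finset.sum_range_succ]
    push_cast
    convert h using 3
    ring

theorem RiemannSumOn.exists_sequences {F : ℝ → Set X} {η a b : ℝ} {S : Set X}
    (h : RiemannSumOn F η a b S) :
    ∃ (n : ℕ) (p ξ : ℕ → ℝ), p 0 = a ∧ p n = b ∧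
      (∀ i < n, ξ i ∈ Set.Icc (p i) (p (i + 1)) ∧ p (i + 1) - p i ≤ η) ∧
      S = ∑ i ∈ Finset.range n, (p (i + 1) - p i) • F (ξ i) := by
  induction h with
  | refl => exact ⟨0, fun _ => a, fun _ => a, rfl, rfl, by simp, by simp⟩
  | @snoc b c x S _ hx hη ih =>
    obtain ⟨n, p, ξ, h0, hn, hi, hS⟩ := ih
    refine ⟨n + 1, Function.update p (n + 1) c, Function.update ξ n x, ?_, ?_, ?_, ?_⟩
    · simpa [Function.update_of_ne] using h0
    · simp
    · intro i hin
      rcases Nat.lt_succ_iff_lt_or_eq.1 hin with h | rfl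
      · rw [Function.update_of_ne (by omega), Function.update_of_ne (by omega),
          Function.update_of_ne (by omega)]
        exact hi i h
      · rw [Function.update_self, Function.update_self, Function.update_of_ne (by omega), hn]
        exact ⟨hx, hη⟩
    · rw [Finset.sum_range_succ, hS]
      congr 1
      · refine Finset.sum_congr rfl fun i hi => ?_
        have := Finset.mem_range.1 hi
        rw [Function.update_of_ne (by omega), Function.update_of_ne (by omega),
          Function.update_of_ne (by omega)]
      · rw [Function.update_self, Function.update_self, Function.update_of_ne (by omega), hn]

theorem RiemannSumOn.exists_taggedPartition {F : ℝ → Set X} {η : ℝ} (hη : 0 ≤ η) {S : Set X}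
    (h : RiemannSumOn F η 0 1 S) : ∃ P : TaggedPartition, P.mesh ≤ η ∧ msum F P = S := by
  obtain ⟨n, p, ξ, h0, hn, hi, hS⟩ := h.exists_sequences
  refine ⟨⟨n, fun i => p i, fun i => ξ i, by simpa using h0, by simpa using hn, ?_, ?_⟩, ?_, ?_⟩
  · refine Fin.monotone_iff_le_succ.2 fun i => ?_
    have := (hi i i.2).1
    simpa using this.1.trans this.2
  · intro i
    simpa using (hi i i.2).1
  · exact Real.iSup_le (fun i => by simpa using (hi i i.2).2) hη
  · rw [hS, Finset.sum_range]
    simp [msum]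

end RiemannSums

section Compact

variable {X : Type*} [NormedAddCommGroup X] [NormedSpace ℝ X]

theorem isCompact_sum_smul {ι : Type*} (s : Finset ι) (c : ι → ℝ) (C : ι → NonemptyCompacts X) :
    IsCompact (∑ i ∈ s, c i • (C i : Set X)) ∧ (∑ i ∈ s, c i • (C i : Set X)).Nonempty := by
  classical
  induction s using Finset.induction_on with
  | empty => simp
  | insert i s hi ih =>
    rw [Finset.sum_insert hi]
    exact ⟨((C i).isCompact.smul _).add ih.1, (C i).nonempty.smul_set.add ih.2⟩

theorem suppFun_sum_smul {ι : Type*} (s : Finset ι) {c : ℝ} (hc : 0 ≤ c)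
    (C : ι → NonemptyCompacts X) (φ : StrongDual ℝ X) :
    suppFun (∑ i ∈ s, c • (C i : Set X)) φ = ∑ i ∈ s, c * suppFun (C i : Set X) φ := by
  classical
  induction s using Finset.induction_on with
  | empty =>
    exact (suppFun_eq (x := 0) (by simp) (by simp)).trans (by simp)
  | insert i s hi ih =>
    obtain ⟨h1, h2⟩ := isCompact_sum_smul s (fun _ => c) C
    rw [Finset.sum_insert hi, Finset.sum_insert hi, suppFun_add ((C i).isCompact.smul _)
      (C i).nonempty.smul_set h1 h2, ih, suppFun_smul (C i).isCompact (C i).nonempty hc]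

omit [NormedSpace ℝ X] in
theorem nearBy_of_dist_lt {K L : NonemptyCompacts X} {r : ℝ} (h : dist K L < r) :
    NearBy r (K : Set X) L := by
  intro x hx
  rw [Metric.NonemptyCompacts.dist_eq] at h
  obtain ⟨y, hy, hxy⟩ := Metric.exists_dist_lt_of_hausdorffDist_lt hx h
    (Metric.hausdorffEDist_ne_top_of_nonempty_of_bounded K.nonempty L.nonempty
      K.isCompact.isBounded L.isCompact.isBounded)
  rw [dist_eq_norm] at hxy
  exact ⟨y, hy, hxy.le⟩

omit [NormedSpace ℝ X] in
theorem dist_le_of_nearBy {K L : NonemptyCompacts X} {r : ℝ} (hr : 0 ≤ r)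
    (hKL : NearBy r (K : Set X) L) (hLK : NearBy r (L : Set X) K) : dist K L ≤ r := by
  rw [Metric.NonemptyCompacts.dist_eq]
  refine Metric.hausdorffDist_le_of_mem_dist hr ?_ ?_
  · simpa only [NearBy, dist_eq_norm] using hKL
  · simpa only [NearBy, dist_eq_norm] using hLK

/-- The space of bounded functions on the unit ball of the dual of `X`. -/
abbrev DualBallFun (X : Type*) [NormedAddCommGroup X] [NormedSpace ℝ X] :=
  lp (fun _ : Metric.closedBall (0 : StrongDual ℝ X) 1 => ℝ) ⊤

theorem memℓp_suppFun (K : NonemptyCompacts X) :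
    Memℓp (fun φ : Metric.closedBall (0 : StrongDual ℝ X) 1 => suppFun (K : Set X) φ.1) ⊤ := by
  obtain ⟨M, hM⟩ := K.isCompact.isBounded.exists_norm_le
  refine memℓp_infty ⟨M, ?_⟩
  rintro _ ⟨φ, rfl⟩
  exact abs_suppFun_le K.isCompact K.nonempty hM (mem_closedBall_zero_iff.1 φ.2)

/-- The support function of a compact set, as a bounded function on the dual unit ball. -/
noncomputable def suppLp (K : NonemptyCompacts X) : DualBallFun X :=
  ⟨fun φ => suppFun (K : Set X) φ.1, memℓp_suppFun K⟩

theorem suppLp_apply (K : NonemptyCompacts X) (φ : Metric.closedBall (0 : StrongDual ℝ X) 1) :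
    suppLp K φ = suppFun (K : Set X) φ.1 := rfl

theorem norm_suppLp_le {K : NonemptyCompacts X} {M : ℝ} (h : ∀ x ∈ K, ‖x‖ ≤ M) :
    ‖suppLp K‖ ≤ M := by
  obtain ⟨x, hx⟩ := K.nonempty
  exact lp.norm_le_of_forall_le ((norm_nonneg x).trans (h x hx)) fun φ =>
    abs_suppFun_le K.isCompact K.nonempty h (mem_closedBall_zero_iff.1 φ.2)

theorem dist_suppLp_le (K L : NonemptyCompacts X) : dist (suppLp K) (suppLp L) ≤ dist K L := by
  refine le_of_forall_gt_imp_ge_of_dense fun r hr => ?_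
  rw [dist_eq_norm]
  refine lp.norm_le_of_forall_le (dist_nonneg.trans hr.le) fun φ => ?_
  have hφ : ‖φ.1‖ ≤ 1 := mem_closedBall_zero_iff.1 φ.2
  have h1 := suppFun_le_of_nearBy K.isCompact K.nonempty L.isCompact L.nonempty
    (nearBy_of_dist_lt hr) hφ
  have h2 := suppFun_le_of_nearBy L.isCompact L.nonempty K.isCompact K.nonempty
    (nearBy_of_dist_lt (by rwa [dist_comm])) hφ
  rw [lp.coeFn_sub, Pi.sub_apply, suppLp_apply, suppLp_apply, Real.norm_eq_abs, abs_le]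
  constructor <;> linarith

theorem continuous_suppLp : Continuous (suppLp (X := X)) :=
  (LipschitzWith.of_dist_le_mul (K := 1) fun K L => by
    simpa using dist_suppLp_le K L).continuous

end Compact

section Integrals

variable {W : Type*} [NormedAddCommGroup W] [NormedSpace ℝ W]

theorem exists_uniformContinuous_integral_sub_le {w : ℝ → W} (hw : Integrable w) {ε : ℝ}
    (hε : 0 < ε) : ∃ u : ℝ → W, Continuous u ∧ Integrable u ∧ ∫ t, ‖w t - u t‖ ≤ ε ∧
      ∃ δ > 0, ∀ s t, |s - t| ≤ δ → ‖u s - u t‖ ≤ ε := by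
  obtain ⟨u, hu1, hu2, hu3, hu4⟩ := hw.exists_hasCompactSupport_integral_sub_le hε
  obtain ⟨δ, hδ, h⟩ := Metric.uniformContinuous_iff.1
    (hu1.uniformContinuous_of_continuous hu3) ε hε
  refine ⟨u, hu3, hu4, hu2, δ / 2, by positivity, fun s t hst => ?_⟩
  rw [← dist_eq_norm]
  exact (h (by rw [Real.dist_eq]; linarith)).le

omit [NormedSpace ℝ W] in
theorem integral_norm_sub_const_le {w u : ℝ → W} (hw : Integrable w) (hu : Integrable u)
    {a b ω : ℝ} (hab : a ≤ b) {c : W} (hc : ∀ t ∈ Set.Icc a b, ‖u t - c‖ ≤ ω) :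
    ∫ t in a..b, ‖w t - c‖ ≤ (∫ t in a..b, ‖w t - u t‖) + ω * (b - a) := by
  have h1 : IntervalIntegrable (fun t => ‖w t - u t‖) volume a b :=
    (hw.sub hu).norm.intervalIntegrable
  have h2 : (∫ t in a..b, ‖w t - u t‖) + ω * (b - a) = ∫ t in a..b, (‖w t - u t‖ + ω) := by
    rw [intervalIntegral.integral_add h1 intervalIntegrable_const]
    simp [mul_comm]
  rw [h2]
  refine intervalIntegral.integral_mono_on hab ?_ (h1.add intervalIntegrable_const) fun t ht => ?_
  · exact (hw.intervalIntegrable.sub intervalIntegrable_const).norm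
  · calc ‖w t - c‖ = ‖(w t - u t) + (u t - c)‖ := by congr 1; abel
      _ ≤ _ := (norm_add_le _ _).trans (add_le_add le_rfl (hc t ht))

theorem norm_smul_sub_integral_le [CompleteSpace W] {w u : ℝ → W} (hw : Integrable w)
    (hu : Integrable u) {a b ω : ℝ} (hab : a ≤ b) {x : ℝ}
    (hx : ∀ t ∈ Set.Icc a b, ‖u t - u x‖ ≤ ω) :
    ‖(b - a) • w x - ∫ t in a..b, w t‖ ≤
      (b - a) * ‖w x - u x‖ + (∫ t in a..b, ‖w t - u t‖) + ω * (b - a) := by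
  have h1 : ∫ t in a..b, (w t - u x) = (∫ t in a..b, w t) - (b - a) • u x := by
    rw [intervalIntegral.integral_sub hw.intervalIntegrable intervalIntegrable_const]
    simp
  have h2 : (b - a) • w x - ∫ t in a..b, w t =
      (b - a) • (w x - u x) - ∫ t in a..b, (w t - u x) := by
    rw [h1, smul_sub]
    abel
  rw [h2, add_assoc]
  refine (norm_sub_le _ _).trans (add_le_add ?_ ?_)
  · rw [norm_smul, Real.norm_of_nonneg (by linarith)]
  · exact (intervalIntegral.norm_integral_le_integral_norm hab).trans
      (integral_norm_sub_const_le hw hu hab hx)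

theorem norm_integral_add_integral_sub_smul_le [CompleteSpace W] {w u : ℝ → W}
    (hw : Integrable w) (hu : Integrable u) {a p q b ω l : ℝ} (hap : a ≤ p) (hpq : p ≤ q)
    (hqb : q ≤ b) (hl0 : 0 ≤ l) (hl1 : l ≤ 1) (hl : (p - a) + (b - q) = l * (b - a))
    (hω : ∀ t ∈ Set.Icc a b, ‖u t - u a‖ ≤ ω) :
    ‖(∫ t in a..p, w t) + (∫ t in q..b, w t) - l • ∫ t in a..b, w t‖ ≤
      2 * ((∫ t in a..b, ‖w t - u t‖) + ω * (b - a)) := by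
  have hab : a ≤ b := by linarith
  have h1 : ∀ x y, ∫ t in x..y, (w t - u a) = (∫ t in x..y, w t) - (y - x) • u a := by
    intro x y
    rw [intervalIntegral.integral_sub hw.intervalIntegrable intervalIntegrable_const]
    simp
  have h2 : (∫ t in a..p, w t) + (∫ t in q..b, w t) - l • ∫ t in a..b, w t =
      (∫ t in a..p, (w t - u a)) + (∫ t in q..b, (w t - u a)) -
        l • ∫ t in a..b, (w t - u a) := by
    rw [h1, h1, h1, smul_sub, smul_smul, ← hl, add_smul]
    abel
  have hint : ∀ x y, IntervalIntegrable (fun t => ‖w t - u a‖) volume x y := fun x y =>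
    (hw.intervalIntegrable.sub intervalIntegrable_const).norm
  have h3 := intervalIntegral.integral_add_adjacent_intervals (hint a p) (hint p q)
  have h4 := intervalIntegral.integral_add_adjacent_intervals (hint a q) (hint q b)
  have h5 : 0 ≤ ∫ t in p..q, ‖w t - u a‖ :=
    intervalIntegral.integral_nonneg hpq fun t _ => norm_nonneg _
  have h6 := integral_norm_sub_const_le hw hu hab hω
  have h7 : 0 ≤ ∫ t in a..b, ‖w t - u a‖ :=
    intervalIntegral.integral_nonneg hab fun t _ => norm_nonneg _
  rw [h2]
  refine (norm_sub_le _ _).trans ?_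
  have h8 := norm_add_le (∫ t in a..p, (w t - u a)) (∫ t in q..b, (w t - u a))
  have h9 := intervalIntegral.norm_integral_le_integral_norm (f := fun t => w t - u a)
    (μ := volume) hap
  have h10 := intervalIntegral.norm_integral_le_integral_norm (f := fun t => w t - u a)
    (μ := volume) hqb
  have h11 : ‖l • ∫ t in a..b, (w t - u a)‖ ≤ ∫ t in a..b, ‖w t - u a‖ := by
    rw [norm_smul, Real.norm_of_nonneg hl0]
    exact (mul_le_of_le_one_left (norm_nonneg _) hl1).trans
      (intervalIntegral.norm_integral_le_integral_norm hab)
  linarith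

theorem IsThick.exists_mul_le_integral {Z : Set ℝ} (hZ : IsThick Z) {ρ : ℝ → ℝ}
    (hρm : Measurable ρ) (hρ : Integrable ρ) {a b : ℝ} (hab : a < b) :
    ∃ t ∈ Set.Icc a b, t ∈ Z ∧ (b - a) * ρ t ≤ ∫ t in a..b, ρ t := by
  have hvol : volume (Set.Ioc a b) = ENNReal.ofReal (b - a) := Real.volume_Ioc
  have hpos := measure_le_setAverage_pos (μ := volume) (s := Set.Ioc a b) (f := ρ)
    (by rw [hvol]; simpa using hab) (by rw [hvol]; simp) hρ.integrableOn
  obtain ⟨t, ⟨ht, hle⟩, htZ⟩ := hZ.inter_nonempty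
    (measurableSet_Ioc.inter (measurableSet_le hρm measurable_const)) hpos.ne'
  refine ⟨t, Set.Ioc_subset_Icc_self ht, htZ, ?_⟩
  have hle : ρ t ≤ ⨍ a in Set.Ioc a b, ρ a := hle
  rw [setAverage_eq, Measure.real, hvol, ENNReal.toReal_ofReal (by linarith), smul_eq_mul,
    ← intervalIntegral.integral_of_le hab.le] at hle
  have hba : 0 < b - a := by linarith
  calc (b - a) * ρ t ≤ (b - a) * ((b - a)⁻¹ * ∫ t in a..b, ρ t) := by gcongr
    _ = _ := by rw [mul_inv_cancel_left₀ hba.ne']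

end Integrals

section Filling

variable {X : Type*} [NormedAddCommGroup X] [NormedSpace ℝ X]

/-- `S` is an almost convex Riemann sum of `C` over `[a, b]` whose support function is close to
`∫ t in a..b, w t`. -/
structure IsFilling (C : ℝ → NonemptyCompacts X) (w : ℝ → DualBallFun X) (η ε a b : ℝ)
    (S : Set X) : Prop where
  riemannSumOn : RiemannSumOn (fun t => (C t : Set X)) η a b S
  isCompact : IsCompact S
  nonempty : S.Nonempty
  nearBy : NearBy ε (convexHull ℝ S) S
  abs_sub_le : ∀ φ : Metric.closedBall (0 : StrongDual ℝ X) 1,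
    |suppFun S φ.1 - (∫ t in a..b, w t) φ| ≤ ε

/-- `w` is an integrable function which, to any precision, agrees on a thick set with the support
function of `C`, the values of `C` being controlled by a measurable compact-valued map. -/
structure IsModel (C : ℝ → NonemptyCompacts X) (g : ℝ → NonemptyCompacts X)
    (w : ℝ → DualBallFun X) : Prop where
  integrable : Integrable w
  stronglyMeasurable : StronglyMeasurable w
  eq_suppLp : ∀ t ∈ Set.Icc (0 : ℝ) 1, w t = suppLp (g t)
  exists_isThick : ∀ ε > 0, ∃ Z, IsThick Z ∧ ∀ t ∈ Z, dist (C t) (g t) < ε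
  exists_finite : ∀ ε > 0, ∃ m : ℕ, ∃ Y : ℕ → NonemptyCompacts X, ∃ G : Set ℝ,
    MeasurableSet G ∧ volume.real G < ε ∧ volume G ≠ ⊤ ∧
      ∀ t ∈ Set.Icc (0 : ℝ) 1, t ∉ G → ∃ j < m, dist (g t) (Y j) < ε

theorem exists_isModel [CompleteSpace X] [SeparableSpace X] {C : ℝ → NonemptyCompacts X} {M : ℝ}
    (hM : ∀ t, ∀ x ∈ C t, ‖x‖ ≤ M) : ∃ g w, IsModel C g w := by
  borelize (NonemptyCompacts X)
  have : Nonempty (NonemptyCompacts X) := ⟨C 0⟩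
  obtain ⟨g, hg, hZ⟩ := exists_measurable_forall_isThick_dist_lt C
  have hsm : StronglyMeasurable fun t => suppLp (g t) :=
    continuous_suppLp.comp_stronglyMeasurable hg.stronglyMeasurable
  have hwm : StronglyMeasurable ((Set.Icc (0 : ℝ) 1).indicator fun t => suppLp (g t)) :=
    hsm.indicator measurableSet_Icc
  have hbd : ∀ᵐ t ∂volume, ‖suppLp (g t)‖ ≤ M + 1 := by
    obtain ⟨Z, hZt, hZd⟩ := hZ 1 one_pos
    refine hZt.ae_of_forall (measurableSet_le hsm.norm.measurable measurable_const) fun t ht => ?_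
    have h1 := dist_suppLp_le (C t) (g t)
    have h2 := norm_suppLp_le (hM t)
    have h3 := norm_le_norm_add_norm_sub (suppLp (C t)) (suppLp (g t))
    rw [dist_eq_norm] at h1
    linarith [hZd t ht]
  refine ⟨g, _, ⟨?_, hwm, fun t ht => Set.indicator_of_mem ht _, hZ, fun ε hε => ?_⟩⟩
  · rw [integrable_indicator_iff measurableSet_Icc]
    exact Measure.integrableOn_of_bounded (by simp) hsm.aestronglyMeasurable
      (ae_restrict_of_ae hbd)
  · let Y := denseSeq (NonemptyCompacts X)
    let G : ℕ → Set ℝ := fun m => Set.Icc 0 1 ∩ {t | ∀ j < m, ε ≤ dist (g t) (Y j)}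
    have hGm : ∀ m, MeasurableSet (G m) := by
      intro m
      refine measurableSet_Icc.inter ?_
      simp only [Set.ofPred_forall]
      exact MeasurableSet.iInter fun j => MeasurableSet.iInter fun _ =>
        measurableSet_le measurable_const (hg.dist measurable_const)
    have hGfin : ∀ m, volume (G m) ≠ ⊤ := fun m =>
      ((measure_mono Set.inter_subset_left).trans_lt (by simp : volume (Set.Icc (0:ℝ) 1) < ⊤)).ne
    have hanti : Antitone G := fun m n hmn t ht => ⟨ht.1, fun j hj => ht.2 j (hj.trans_le hmn)⟩
    have hlim := tendsto_measure_iInter_atTop (μ := volume)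
      (fun m => (hGm m).nullMeasurableSet) hanti ⟨0, hGfin 0⟩
    have hemp : ⋂ m, G m = ∅ := by
      rw [Set.eq_empty_iff_forall_notMem]
      intro t ht
      obtain ⟨j, hj⟩ := (denseRange_denseSeq (NonemptyCompacts X)).exists_dist_lt (g t) hε
      exact absurd ((Set.mem_iInter.1 ht (j + 1)).2 j (by omega)) (not_le.2 hj)
    rw [hemp, measure_empty] at hlim
    obtain ⟨m, hm⟩ := (hlim.eventually (gt_mem_nhds (ENNReal.ofReal_pos.2 hε))).exists
    refine ⟨m, Y, G m, hGm m, ?_, hGfin m, fun t ht htG => ?_⟩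
    · exact (ENNReal.lt_ofReal_iff_toReal_lt (hGfin m)).1 hm
    · by_contra! hcon
      exact htG ⟨ht, hcon⟩

theorem IsModel.exists_isFilling {C g : ℝ → NonemptyCompacts X} {w : ℝ → DualBallFun X}
    (hw : IsModel C g w) {M : ℝ} (hM : ∀ t, ∀ x ∈ C t, ‖x‖ ≤ M) {a b η ε : ℝ} (ha : 0 ≤ a)
    (hab : a ≤ b) (hb : b ≤ 1) (hη : 0 < η) (hε : 0 < ε) : ∃ S, IsFilling C w η ε a b S := by
  classical
  rcases hab.eq_or_lt with rfl | hab
  · refine ⟨0, RiemannSumOn.refl a, isCompact_singleton, ⟨0, rfl⟩, ?_, fun φ => ?_⟩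
    · intro x hx
      rw [convexHull_zero] at hx
      exact ⟨x, hx, by simpa using hε.le⟩
    · have h0 : suppFun (0 : Set X) φ.1 = 0 :=
        (suppFun_eq (x := 0) (by simp) (by simp)).trans (by simp)
      simpa [h0] using hε.le
  have hM0 : 0 ≤ M := by
    obtain ⟨x, hx⟩ := (C 0).nonempty
    exact (norm_nonneg x).trans (hM 0 x hx)
  obtain ⟨e, he, heε⟩ : ∃ e > 0, (7 + 4 * M) * e ≤ ε :=
    ⟨ε / (7 + 4 * M), by positivity, by rw [mul_div_cancel₀ _ (by positivity)]⟩
  obtain ⟨u, huc, hui, hwu, δ, hδ, hu⟩ := exists_uniformContinuous_integral_sub_le hw.integrable he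
  obtain ⟨m, Y, G, hGm, hGe, hGfin, hG⟩ := hw.exists_finite e he
  obtain ⟨Z, hZ, hZC⟩ := hw.exists_isThick e he
  obtain ⟨K, hK⟩ := exists_nearBy_convexHull_sum (m := m) (Y := fun j => (Y j : Set X)) (M := M)
    (fun j => (Y j).isCompact) (show 0 < 2 * e by positivity)
  let ρ : ℝ → ℝ := fun t => ‖w t - u t‖ + G.indicator (fun _ => (1 : ℝ)) t
  have hGint : Integrable (G.indicator fun _ => (1 : ℝ)) :=
    (integrable_indicator_iff hGm).2 (integrableOn_const hGfin)
  have hρm : Measurable ρ :=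
    (hw.stronglyMeasurable.sub huc.stronglyMeasurable).norm.measurable.add
      (measurable_const.indicator hGm)
  have hwui : Integrable fun t => ‖w t - u t‖ := (hw.integrable.sub hui).norm
  have hρi : Integrable ρ := hwui.add hGint
  have hG0 : ∀ t, 0 ≤ G.indicator (fun _ => (1 : ℝ)) t := fun t =>
    Set.indicator_nonneg (fun _ _ => zero_le_one) t
  have hρ0 : ∀ t, 0 ≤ ρ t := fun t => add_nonneg (norm_nonneg _) (hG0 t)
  have hρ2 : ∫ t, ρ t ≤ 2 * e := by
    have : ∫ t, ρ t = (∫ t, ‖w t - u t‖) + volume.real G := by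
      rw [integral_add hwui hGint, integral_indicator hGm]
      simp
    linarith
  have hρab : ∫ t in a..b, ρ t ≤ 2 * e := by
    rw [intervalIntegral.integral_of_le hab.le]
    exact (setIntegral_le_integral hρi (Eventually.of_forall hρ0)).trans hρ2
  have hba : 0 < b - a := by linarith
  obtain ⟨N, hN⟩ := exists_nat_gt (max ((b - a) / η) (max ((b - a) / δ) ((b - a) * K / e)))
  obtain ⟨hN1, hN⟩ := max_lt_iff.1 hN
  obtain ⟨hN2, hN3⟩ := max_lt_iff.1 hN
  have hNpos : (0 : ℝ) < N := lt_of_le_of_lt (by positivity) hN1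
  obtain ⟨d, hd⟩ : ∃ d, d = (b - a) / N := ⟨_, rfl⟩
  have hd0 : 0 < d := by rw [hd]; positivity
  have hNd : N * d = b - a := by rw [hd]; field_simp
  have hdη : d ≤ η := by
    rw [hd, div_le_iff₀ hNpos]; rw [div_lt_iff₀ hη] at hN1; linarith
  have hdδ : d ≤ δ := by
    rw [hd, div_le_iff₀ hNpos]; rw [div_lt_iff₀ hδ] at hN2; linarith
  have hdK : d * K ≤ e := by
    rw [hd, div_mul_eq_mul_div, div_le_iff₀ hNpos]; rw [div_lt_iff₀ he] at hN3; linarith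
  let p : ℕ → ℝ := fun i => a + i * d
  have hp : ∀ i, p (i + 1) - p i = d := fun i => by simp only [p]; push_cast; ring
  have hplt : ∀ i, p i < p (i + 1) := fun i => by linarith [hp i]
  have hp0 : p 0 = a := by simp [p]
  have hpN : p N = b := by simp only [p]; linarith
  have hexists : ∀ i, ∃ t ∈ Set.Icc (p i) (p (i + 1)), t ∈ Z ∧
      d * ρ t ≤ ∫ t in p i..p (i + 1), ρ t := by
    intro i
    have := hZ.exists_mul_le_integral hρm hρi (hplt i)
    rwa [hp] at this
  choose t ht htZ htρ using hexists
  have ht01 : ∀ i < N, t i ∈ Set.Icc (0 : ℝ) 1 := by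
    intro i hi
    have h1 : p 0 ≤ p i := by simp only [p]; gcongr; simp
    have h2 : p (i + 1) ≤ p N := by simp only [p]; gcongr; exact_mod_cast hi
    exact ⟨by linarith [(ht i).1], by linarith [(ht i).2]⟩
  have hsumρ : ∑ i ∈ Finset.range N, ∫ t in p i..p (i + 1), ρ t ≤ 2 * e := by
    rw [intervalIntegral.sum_integral_adjacent_intervals
      (fun _ _ => hρi.intervalIntegrable), hp0, hpN]
    exact hρab
  let bad : Finset ℕ := (Finset.range N).filter fun i => t i ∈ G
  have hbad : d * bad.card ≤ 2 * e := by
    calc d * bad.card = ∑ i ∈ bad, d * 1 := by simp [mul_comm]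
      _ ≤ ∑ i ∈ bad, d * ρ (t i) := by
        refine Finset.sum_le_sum fun i hi => ?_
        have hiG := (Finset.mem_filter.1 hi).2
        have : 1 ≤ ρ (t i) := by simp [ρ, hiG]
        gcongr
      _ ≤ ∑ i ∈ Finset.range N, d * ρ (t i) :=
        Finset.sum_le_sum_of_subset_of_nonneg (Finset.filter_subset _ _)
          fun i _ _ => mul_nonneg hd0.le (hρ0 _)
      _ ≤ _ := (Finset.sum_le_sum fun i _ => htρ i).trans hsumρ
  obtain ⟨hcpt, hne⟩ := isCompact_sum_smul (Finset.range N) (fun _ => d) fun i => C (t i)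
  refine ⟨∑ i ∈ Finset.range N, d • (C (t i) : Set X), ?_, hcpt, hne, ?_, fun φ => ?_⟩
  · have := RiemannSumOn.equal (F := fun t => (C t : Set X)) (a := a) hdη (t := t) (N := N)
      fun i _ => by simpa [p] using ht i
    rwa [show a + N * d = b by linarith] at this
  · refine (hK (Finset.range N) bad (fun i => (C (t i) : Set X)) d (Finset.filter_subset _ _)
      hd0.le (fun i _ => hM (t i)) (fun i _ => (C (t i)).nonempty) fun i hi => ?_).mono ?_
    · obtain ⟨hiN, hib⟩ := Finset.mem_sdiff.1 hi
      obtain ⟨j, hj, hjd⟩ := hG (t i) (ht01 i (Finset.mem_range.1 hiN))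
        fun h => hib (Finset.mem_filter.2 ⟨hiN, h⟩)
      have hd2 : dist (C (t i)) (Y j) < 2 * e := by
        have := dist_triangle (C (t i)) (g (t i)) (Y j)
        linarith [hZC _ (htZ i)]
      exact ⟨j, hj, nearBy_of_dist_lt hd2, nearBy_of_dist_lt (by rwa [dist_comm])⟩
    · rw [Finset.card_range]
      have h1 : M * (d * bad.card) ≤ M * (2 * e) := by gcongr
      have h2 : e * (N * d) ≤ e * 1 := by rw [hNd]; gcongr; linarith
      nlinarith
  · have hkey : ‖∑ i ∈ Finset.range N, d • suppLp (C (t i)) - ∫ t in a..b, w t‖ ≤ 6 * e := by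
      have hsplit : ∫ t in a..b, w t = ∑ i ∈ Finset.range N, ∫ t in p i..p (i + 1), w t := by
        rw [intervalIntegral.sum_integral_adjacent_intervals
          (fun _ _ => hw.integrable.intervalIntegrable), hp0, hpN]
      rw [hsplit, ← Finset.sum_sub_distrib]
      refine (norm_sum_le_of_le (n := fun i => 2 * (∫ t in p i..p (i + 1), ρ t) + 2 * e * d) _
        fun i hi => ?_).trans ?_
      · have h1 : ‖d • suppLp (C (t i)) - d • w (t i)‖ ≤ d * e := by
          rw [← smul_sub, norm_smul, Real.norm_of_nonneg hd0.le,
            hw.eq_suppLp _ (ht01 i (Finset.mem_range.1 hi)), ← dist_eq_norm]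
          gcongr
          exact (dist_suppLp_le _ _).trans (hZC _ (htZ i)).le
        have h2 := norm_smul_sub_integral_le hw.integrable hui (hplt i).le (x := t i) (ω := e)
          fun s hs => hu _ _ (by
            rw [abs_le]
            constructor <;> linarith [hs.1, hs.2, (ht i).1, (ht i).2, hp i])
        rw [hp] at h2
        have h3 : d * ‖w (t i) - u (t i)‖ ≤ ∫ t in p i..p (i + 1), ρ t :=
          le_trans (by gcongr; exact le_add_of_nonneg_right (hG0 _)) (htρ i)
        have h4 : ∫ t in p i..p (i + 1), ‖w t - u t‖ ≤ ∫ t in p i..p (i + 1), ρ t :=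
          intervalIntegral.integral_mono_on (hplt i).le hwui.intervalIntegrable
            hρi.intervalIntegrable fun s _ => le_add_of_nonneg_right (hG0 s)
        have h5 := norm_sub_le_norm_sub_add_norm_sub (d • suppLp (C (t i))) (d • w (t i))
          (∫ t in p i..p (i + 1), w t)
        linarith
      · rw [Finset.sum_add_distrib, ← Finset.mul_sum]
        simp only [Finset.sum_const, Finset.card_range, nsmul_eq_mul]
        have h2 : e * (N * d) ≤ e * 1 := by rw [hNd]; gcongr; linarith
        linarith
    have h1 := (lp.norm_apply_le_norm ENNReal.top_ne_zero _ φ).trans hkey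
    have h2 : (∑ i ∈ Finset.range N, d • suppLp (C (t i)) - ∫ t in a..b, w t : DualBallFun X) φ =
        suppFun (∑ i ∈ Finset.range N, d • (C (t i) : Set X)) φ.1 - (∫ t in a..b, w t) φ := by
      rw [suppFun_sum_smul _ hd0.le]
      rw [lp.coeFn_sub, Pi.sub_apply, lp.coeFn_sum, Finset.sum_apply]
      rfl
    rw [h2, Real.norm_eq_abs] at h1
    refine h1.trans (le_trans ?_ heε)
    nlinarith

end Filling

section Mixing

variable {X : Type*} [NormedAddCommGroup X] [NormedSpace ℝ X]

theorem TaggedPartition.mesh_nonneg_s15 (P : TaggedPartition) : 0 ≤ P.mesh :=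
  Real.iSup_nonneg fun _ => sub_nonneg.2 (P.pt_mono (Fin.castSucc_lt_succ).le)

theorem TaggedPartition.exists_sequences (P : TaggedPartition) : ∃ p ξ : ℕ → ℝ,
    p 0 = 0 ∧ p P.n = 1 ∧ (∀ i ≤ P.n, p i ∈ Set.Icc (0 : ℝ) 1) ∧
      (∀ i < P.n, ξ i ∈ Set.Icc (p i) (p (i + 1)) ∧ p (i + 1) - p i ≤ P.mesh) ∧
      ∀ F : ℝ → Set X, msum F P = ∑ i ∈ Finset.range P.n, (p (i + 1) - p i) • F (ξ i) := by
  let p : ℕ → ℝ := fun i => if h : i < P.n + 1 then P.pt ⟨i, h⟩ else 1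
  let ξ : ℕ → ℝ := fun i => if h : i < P.n then P.tag ⟨i, h⟩ else 1
  have hp : ∀ i : Fin (P.n + 1), p i = P.pt i := fun i => dif_pos i.2
  have hξ : ∀ i : Fin P.n, ξ i = P.tag i := fun i => dif_pos i.2
  have h0 : p 0 = 0 := (hp 0).trans P.pt_zero
  have hn : p P.n = 1 := (hp (Fin.last P.n)).trans P.pt_last
  have hc : ∀ i : Fin P.n, p i = P.pt i.castSucc := fun i => hp i.castSucc
  have hs : ∀ i : Fin P.n, p (i + 1) = P.pt i.succ := fun i => hp i.succ
  refine ⟨p, ξ, h0, hn, fun i hi => ?_, fun i hi => ?_, fun F => ?_⟩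
  · have := hp ⟨i, by omega⟩
    simp only at this
    rw [this, ← P.pt_zero, ← P.pt_last]
    exact ⟨P.pt_mono (Fin.zero_le _), P.pt_mono (Fin.le_last _)⟩
  · have h1 := hc ⟨i, hi⟩
    have h2 := hs ⟨i, hi⟩
    have h3 := hξ ⟨i, hi⟩
    simp only at h1 h2 h3
    rw [h1, h2, h3]
    exact ⟨P.tag_mem _, le_ciSup (f := fun i : Fin P.n => P.pt i.succ - P.pt i.castSucc)
      (Set.finite_range _).bddAbove ⟨i, hi⟩⟩
  · rw [Finset.sum_range, msum]
    simp only [hc, hs, hξ]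

theorem IsModel.exists_mixed_sum [CompleteSpace X] {C g : ℝ → NonemptyCompacts X}
    {w u : ℝ → DualBallFun X} (hw : IsModel C g w) {M : ℝ} (hM : ∀ t, ∀ x ∈ C t, ‖x‖ ≤ M)
    (hui : Integrable u) {δ e : ℝ} (hu : ∀ s t, |s - t| ≤ δ → ‖u s - u t‖ ≤ e) {η ε l : ℝ}
    (hη : 0 < η) (hε : 0 < ε) (hl : l ∈ Set.Icc (0 : ℝ) 1) {n : ℕ} {p ξ : ℕ → ℝ} (hp0 : p 0 = 0)
    (hp : ∀ i ≤ n, p i ∈ Set.Icc (0 : ℝ) 1)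
    (hξ : ∀ i < n, ξ i ∈ Set.Icc (p i) (p (i + 1)) ∧ p (i + 1) - p i ≤ min δ η) :
    ∀ j ≤ n, ∃ T : Set X, RiemannSumOn (fun t => (C t : Set X)) η 0 (p j)
        (∑ i ∈ Finset.range j, ((1 - l) * (p (i + 1) - p i)) • (C (ξ i) : Set X) + T) ∧
      IsCompact T ∧ T.Nonempty ∧ NearBy (j * (2 * ε)) (convexHull ℝ T) T ∧
      ∀ φ : Metric.closedBall (0 : StrongDual ℝ X) 1,
        |suppFun T φ.1 - (l • ∫ t in (0 : ℝ)..p j, w t) φ| ≤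
          j * (2 * ε) + 2 * ((∫ t in (0 : ℝ)..p j, ‖w t - u t‖) + e * p j) := by
  intro j
  induction j with
  | zero =>
    intro _
    refine ⟨0, ?_, isCompact_singleton, ⟨0, rfl⟩, ?_, fun φ => ?_⟩
    · simpa [hp0] using RiemannSumOn.refl (F := fun t => (C t : Set X)) (η := η) 0
    · intro x hx
      rw [convexHull_zero] at hx
      exact ⟨x, hx, by simp⟩
    · have h0 : suppFun (0 : Set X) φ.1 = 0 :=
        (suppFun_eq (x := 0) (by simp) (by simp)).trans (by simp)
      simp [h0, hp0]
  | succ j ih =>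
    intro hj
    obtain ⟨T, hT, hTc, hTne, hTconv, hTφ⟩ := ih (by omega)
    obtain ⟨hx, hd⟩ := hξ j hj
    obtain ⟨ha, -⟩ := hp j (by omega)
    obtain ⟨-, hb⟩ := hp (j + 1) hj
    obtain ⟨hdδ, hdη⟩ := le_min_iff.1 hd
    obtain ⟨hl0, hl1⟩ := hl
    obtain ⟨hax, hxb⟩ := hx
    simp only [Finset.sum_range_succ]
    generalize p (j + 1) = b at *
    generalize p j = a at *
    generalize ξ j = x at *
    obtain ⟨c, hc⟩ : ∃ c, c = a + l * (x - a) := ⟨_, rfl⟩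
    obtain ⟨d, hd⟩ : ∃ d, d = b - l * (b - x) := ⟨_, rfl⟩
    have hac : a ≤ c := by nlinarith
    have hcx : c ≤ x := by nlinarith
    have hxd : x ≤ d := by nlinarith
    have hdb : d ≤ b := by nlinarith
    obtain ⟨S, hS⟩ := hw.exists_isFilling hM ha hac (by linarith) hη hε
    obtain ⟨R, hR⟩ := hw.exists_isFilling hM (by linarith : 0 ≤ d) hdb hb hη hε
    have hSR := hS.isCompact.add hR.isCompact
    have hSRne := hS.nonempty.add hR.nonempty
    refine ⟨T + (S + R), ?_, hTc.add hSR, hTne.add hSRne, ?_, fun φ => ?_⟩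
    · have h := ((hT.append hS.riemannSumOn).snoc (ξ := x) ⟨hcx, hxd⟩ (by linarith)).append
        hR.riemannSumOn
      rw [show d - c = (1 - l) * (b - a) by rw [hc, hd]; ring] at h
      convert h using 1
      abel
    · rw [convexHull_add, convexHull_add]
      refine (hTconv.add (hS.nearBy.add hR.nearBy)).mono ?_
      push_cast
      linarith
    · have h1 := hTφ φ
      have h2 := hS.abs_sub_le φ
      have h3 := hR.abs_sub_le φ
      have h4 := norm_integral_add_integral_sub_smul_le hw.integrable hui hac (hcx.trans hxd) hdb
        hl0 hl1 (by rw [hc, hd]; ring) (ω := e) fun t ht => hu t a (by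
          rw [abs_le]; constructor <;> linarith [ht.1, ht.2])
      have h5 := (lp.norm_apply_le_norm ENNReal.top_ne_zero _ φ).trans h4
      have h6 : l • ∫ t in (0 : ℝ)..b, w t =
          (l • ∫ t in (0 : ℝ)..a, w t) + l • ∫ t in a..b, w t := by
        rw [← smul_add, intervalIntegral.integral_add_adjacent_intervals
          hw.integrable.intervalIntegrable hw.integrable.intervalIntegrable]
      have h7 : (∫ t in (0 : ℝ)..a, ‖w t - u t‖) + ∫ t in a..b, ‖w t - u t‖ =
          ∫ t in (0 : ℝ)..b, ‖w t - u t‖ :=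
        intervalIntegral.integral_add_adjacent_intervals
          (hw.integrable.sub hui).norm.intervalIntegrable
          (hw.integrable.sub hui).norm.intervalIntegrable
      rw [suppFun_add hTc hTne hSR hSRne, suppFun_add hS.isCompact hS.nonempty hR.isCompact
        hR.nonempty, h6, ← h7]
      rw [lp.coeFn_sub, lp.coeFn_add, Pi.sub_apply, Pi.add_apply, Real.norm_eq_abs] at h5
      rw [lp.coeFn_add, Pi.add_apply]
      rw [abs_le] at h1 h2 h3 h5 ⊢
      push_cast
      constructor <;> linarith

end Mixing

section Limit

variable {X : Type*} [NormedAddCommGroup X] [NormedSpace ℝ X]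

theorem mem_limitSets_of_forall_exists {F : ℝ → Set X} {B : Set X} (hne : B.Nonempty)
    (hcl : IsClosed B)
    (h : ∀ ε > 0, ∃ Q : TaggedPartition, Q.mesh ≤ ε ∧ NearBy ε (msum F Q) B ∧
      NearBy ε B (msum F Q)) : B ∈ limitSets F := by
  choose Q hQ hQB hBQ using fun k : ℕ => h (1 / ((k : ℝ) + 1)) Nat.one_div_pos_of_nat
  refine ⟨hne, hcl, Q, ?_, ?_⟩
  · exact squeeze_zero (fun k => (Q k).mesh_nonneg_s15) hQ tendsto_one_div_add_atTop_nhds_zero_nat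
  · refine tendsto_of_tendsto_of_tendsto_of_le_of_le tendsto_const_nhds ?_ (fun _ => zero_le)
      fun k => hausdorffEDist_le_of_nearBy (hQB k) (hBQ k)
    simpa using ENNReal.tendsto_ofReal tendsto_one_div_add_atTop_nhds_zero_nat

/-- The closed convex hull of a nonempty compact set. -/
noncomputable def closedConvexHullCompacts [CompleteSpace X] (S : Set X) (hS : IsCompact S)
    (hne : S.Nonempty) : NonemptyCompacts X :=
  ⟨⟨closure (convexHull ℝ S),
    (totallyBounded_convexHull.2 hS.totallyBounded).closure.isCompact_of_isClosed isClosed_closure⟩,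
    hne.convexHull.closure⟩

theorem IsModel.exists_limit [CompleteSpace X] {C g : ℝ → NonemptyCompacts X}
    {w : ℝ → DualBallFun X} (hw : IsModel C g w) {M : ℝ} (hM : ∀ t, ∀ x ∈ C t, ‖x‖ ≤ M) :
    ∃ A : NonemptyCompacts X, (A : Set X) ∈ limitSets (fun t => (C t : Set X)) ∧
      Convex ℝ (A : Set X) ∧ ∀ φ : Metric.closedBall (0 : StrongDual ℝ X) 1,
        suppFun (A : Set X) φ.1 = (∫ t in (0 : ℝ)..1, w t) φ := by
  let e : ℕ → ℝ := fun k => 1 / ((k : ℝ) + 1)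
  have he : ∀ k, 0 < e k := fun k => Nat.one_div_pos_of_nat
  have helim : Tendsto e atTop (nhds 0) := tendsto_one_div_add_atTop_nhds_zero_nat
  have hanti : ∀ m n, m ≤ n → e n ≤ e m := fun m n h => Nat.one_div_le_one_div h
  choose S hS using fun k => hw.exists_isFilling hM le_rfl zero_le_one le_rfl (he k) (he k)
  let K : ℕ → NonemptyCompacts X := fun k =>
    closedConvexHullCompacts (S k) (hS k).isCompact (hS k).nonempty
  have hKc : ∀ k, Convex ℝ (K k : Set X) := fun k => (convex_convexHull ℝ _).closure
  have hKφ : ∀ k φ, suppFun (K k : Set X) φ = suppFun (S k) φ := fun k φ =>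
    suppFun_closure_convexHull (hS k).isCompact (hS k).nonempty φ
  have hKd : ∀ k (φ : Metric.closedBall (0 : StrongDual ℝ X) 1),
      |suppFun (K k : Set X) φ.1 - (∫ t in (0 : ℝ)..1, w t) φ| ≤ e k := fun k φ => by
    rw [hKφ]
    exact (hS k).abs_sub_le φ
  have hnear : ∀ m n, NearBy (2 * (e m + e n)) (K m : Set X) (K n) := fun m n => by
    have h1 := he m
    have h2 := he n
    refine nearBy_of_suppFun_le (r := e m + e n) (hKc n) (K n).nonempty (K m).isCompact
      (by linarith) (by linarith) fun φ hφ => ?_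
    have h3 := hKd m ⟨φ, mem_closedBall_zero_iff.2 hφ⟩
    have h4 := hKd n ⟨φ, mem_closedBall_zero_iff.2 hφ⟩
    rw [abs_le] at h3 h4
    linarith [h3.2, h4.1]
  have hdist : ∀ m n, dist (K m) (K n) ≤ 2 * (e m + e n) := fun m n =>
    dist_le_of_nearBy (by linarith [he m, he n]) (hnear m n) (by rw [add_comm]; exact hnear n m)
  have hcau : CauchySeq K := by
    refine cauchySeq_of_le_tendsto_0 (fun k => 4 * e k) (fun m n N hm hn => ?_) ?_
    · linarith [hdist m n, hanti N m hm, hanti N n hn]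
    · simpa using helim.const_mul 4
  obtain ⟨A, hA⟩ := cauchySeq_tendsto_of_complete hcau
  have hclose : ∀ r > 0, ∃ k, e k < r ∧ NearBy r (A : Set X) (K k) ∧ NearBy r (K k : Set X) A := by
    intro r hr
    obtain ⟨k, hk1, hk2⟩ := ((helim.eventually (gt_mem_nhds hr)).and
      (hA.eventually (Metric.ball_mem_nhds A hr))).exists
    exact ⟨k, hk1, nearBy_of_dist_lt (by rwa [dist_comm]), nearBy_of_dist_lt hk2⟩
  refine ⟨A, ?_, ?_, fun φ => ?_⟩
  · refine mem_limitSets_of_forall_exists A.nonempty A.isCompact.isClosed fun ε hε => ?_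
    obtain ⟨k, hk, hAK, hKA⟩ := hclose (ε / 4) (by positivity)
    obtain ⟨Q, hQ, hQS⟩ := (hS k).riemannSumOn.exists_taggedPartition (he k).le
    have hcl : NearBy (ε / 4) (closure (convexHull ℝ (S k))) (convexHull ℝ (S k)) := by
      intro x hx
      obtain ⟨y, hy, hxy⟩ := Metric.mem_closure_iff.1 hx (ε / 4) (by positivity)
      exact ⟨y, hy, by rw [← dist_eq_norm]; exact hxy.le⟩
    refine ⟨Q, by linarith, ?_, ?_⟩
    · rw [hQS]
      exact NearBy.mono (fun x hx => hKA x (subset_closure (subset_convexHull ℝ _ hx)))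
        (by linarith)
    · rw [hQS]
      exact ((hAK.trans hcl).trans (hS k).nearBy).mono (by linarith)
  · have hsub : convexHull ℝ (A : Set X) ⊆ A := by
      intro x hx
      rw [← A.isCompact.isClosed.closure_eq, Metric.mem_closure_iff]
      intro r hr
      obtain ⟨k, -, hAK, hKA⟩ := hclose (r / 4) (by positivity)
      obtain ⟨y, hy, hxy⟩ := ((hAK.convexHull_left (hKc k)).trans hKA) x hx
      exact ⟨y, hy, by rw [dist_eq_norm]; linarith⟩
    rw [← hsub.antisymm (subset_convexHull ℝ _)]
    exact convex_convexHull ℝ _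
  · refine eq_of_forall_dist_le fun r hr => ?_
    obtain ⟨k, hk, hAK, hKA⟩ := hclose (r / 2) (by positivity)
    have hφ := mem_closedBall_zero_iff.1 φ.2
    have h1 := suppFun_le_of_nearBy A.isCompact A.nonempty (K k).isCompact (K k).nonempty hAK hφ
    have h2 := suppFun_le_of_nearBy (K k).isCompact (K k).nonempty A.isCompact A.nonempty hKA hφ
    have h3 := hKd k φ
    rw [Real.dist_eq]
    rw [abs_le] at h3 ⊢
    constructor <;> linarith [h3.1, h3.2]

theorem IsModel.smul_add_smul_mem_limitSets [CompleteSpace X] {C g : ℝ → NonemptyCompacts X}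
    {w : ℝ → DualBallFun X} (hw : IsModel C g w) {M : ℝ} (hM : ∀ t, ∀ x ∈ C t, ‖x‖ ≤ M)
    {A : NonemptyCompacts X} (hA : Convex ℝ (A : Set X))
    (hAφ : ∀ φ : Metric.closedBall (0 : StrongDual ℝ X) 1,
      suppFun (A : Set X) φ.1 = (∫ t in (0 : ℝ)..1, w t) φ) {B : Set X}
    (hB : B ∈ limitSets (fun t => (C t : Set X))) {l : ℝ} (hl : l ∈ Set.Icc (0 : ℝ) 1) :
    l • (A : Set X) + (1 - l) • B ∈ limitSets (fun t => (C t : Set X)) := by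
  obtain ⟨hBne, hBcl, P, hPmesh, hPB⟩ := hB
  have hlB : IsClosed ((1 - l) • B) := by
    rcases eq_or_ne (1 - l) 0 with h | h
    · rw [h, Set.zero_smul_set hBne]
      exact isClosed_singleton
    · exact hBcl.smul_of_ne_zero h
  have hlA : IsCompact (l • (A : Set X)) := A.isCompact.smul l
  have hl0 := hl.1
  have hl1 : 0 ≤ 1 - l := by linarith [hl.2]
  refine mem_limitSets_of_forall_exists (A.nonempty.smul_set.add hBne.smul_set)
    (hlB.add_left_of_isCompact hlA) fun ε hε => ?_
  obtain ⟨e, he, heε⟩ : ∃ e > 0, 20 * e ≤ ε := ⟨ε / 20, by positivity, by linarith⟩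
  obtain ⟨u, -, hui, hwu, δ, hδ, hu⟩ := exists_uniformContinuous_integral_sub_le hw.integrable he
  obtain ⟨k, hkmesh, hkB⟩ := ((hPmesh.eventually (gt_mem_nhds (lt_min hδ hε))).and
    (hPB.eventually (gt_mem_nhds (ENNReal.ofReal_pos.2 he)))).exists
  have hPB1 : NearBy e (msum (fun t => (C t : Set X)) (P k)) B := nearBy_of_hausdorffEDist_lt hkB
  have hPB2 : NearBy e B (msum (fun t => (C t : Set X)) (P k)) :=
    nearBy_of_hausdorffEDist_lt (by rw [Metric.hausdorffEDist_comm]; exact hkB)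
  obtain ⟨p, ξ, hp0, hpn, hp, hξ, hsum⟩ := (P k).exists_sequences (X := X)
  obtain ⟨ρ, hρ, hρe⟩ : ∃ ρ > 0, (P k).n * (2 * ρ) ≤ e := by
    refine ⟨e / (2 * ((P k).n + 1)), by positivity, ?_⟩
    rw [← mul_assoc, ← mul_div_assoc, div_le_iff₀ (by positivity)]
    nlinarith
  obtain ⟨T, hT, hTc, hTne, hTconv, hTφ⟩ := hw.exists_mixed_sum hM hui hu hε hρ hl hp0 hp
    (fun i hi => ⟨(hξ i hi).1, (hξ i hi).2.trans hkmesh.le⟩) (P k).n le_rfl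
  have hsum' : ∑ i ∈ Finset.range (P k).n, ((1 - l) * (p (i + 1) - p i)) • (C (ξ i) : Set X) =
      (1 - l) • msum (fun t => (C t : Set X)) (P k) := by
    rw [hsum, Finset.smul_sum]
    simp only [mul_smul]
  rw [hpn, hsum'] at hT
  rw [hpn] at hTφ
  have hint : ∫ t in (0 : ℝ)..1, ‖w t - u t‖ ≤ e := by
    rw [intervalIntegral.integral_of_le zero_le_one]
    exact (setIntegral_le_integral (hw.integrable.sub hui).norm
      (Eventually.of_forall fun _ => norm_nonneg _)).trans hwu
  have hTA : ∀ φ : StrongDual ℝ X, ‖φ‖ ≤ 1 →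
      |suppFun T φ - suppFun (l • (A : Set X)) φ| ≤ 5 * e := by
    intro φ hφ
    have h1 := hTφ ⟨φ, mem_closedBall_zero_iff.2 hφ⟩
    have h2 := hAφ ⟨φ, mem_closedBall_zero_iff.2 hφ⟩
    rw [lp.coeFn_smul, Pi.smul_apply, ← h2, smul_eq_mul,
      ← suppFun_smul A.isCompact A.nonempty hl0] at h1
    exact h1.trans (by linarith)
  have hnear1 : NearBy (6 * e) T (l • (A : Set X)) :=
    nearBy_of_suppFun_le (r := 5 * e) (hA.smul l) A.nonempty.smul_set hTc (by linarith)
      (by linarith) fun φ hφ => by linarith [(abs_le.1 (hTA φ hφ)).2]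
  have hnear2 : NearBy (6 * e) (l • (A : Set X)) (convexHull ℝ T) :=
    nearBy_of_suppFun_le (r := 5 * e) (convex_convexHull ℝ T) hTne.convexHull hlA (by linarith)
      (by linarith) fun φ hφ => by
        rw [suppFun_convexHull hTc hTne]
        linarith [(abs_le.1 (hTA φ hφ)).1]
  have hle : (1 - l) * e ≤ e := mul_le_of_le_one_left he.le (by linarith)
  obtain ⟨Q, hQ, hQS⟩ := hT.exists_taggedPartition hε.le
  refine ⟨Q, hQ, ?_, ?_⟩
  · rw [hQS, add_comm]
    exact (hnear1.add (hPB1.smul hl1)).mono (by linarith)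
  · rw [hQS, add_comm]
    exact ((hPB2.smul hl1).add (hnear2.trans hTconv)).mono (by linarith)

end Limit

/-- For a compact-valued bounded multifunction on `[0,1]` with values in a separable real
Banach space, `I(F)` is star-shaped (in particular, nonempty). -/
theorem limitSets_starShaped_of_separable
    {X : Type*} [NormedAddCommGroup X] [NormedSpace ℝ X] [CompleteSpace X]
    [TopologicalSpace.SeparableSpace X]
    (F : ℝ → Set X)
    (hFne : ∀ t ∈ Set.Icc (0 : ℝ) 1, (F t).Nonempty)
    (hFcpt : ∀ t ∈ Set.Icc (0 : ℝ) 1, IsCompact (F t))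
    (hFbdd : ∃ M : ℝ, ∀ t ∈ Set.Icc (0 : ℝ) 1, ∀ a ∈ F t, ‖a‖ ≤ M) :
    ∃ A₀ ∈ limitSets F, ∀ A ∈ limitSets F, ∀ l ∈ Set.Icc (0 : ℝ) 1,
      l • A₀ + (1 - l) • A ∈ limitSets F := by
  obtain ⟨M, hM⟩ := hFbdd
  let r : ℝ → ℝ := fun t => Set.projIcc (0 : ℝ) 1 zero_le_one t
  have hr : ∀ t, r t ∈ Set.Icc (0 : ℝ) 1 := fun t => Subtype.coe_prop _
  let C : ℝ → NonemptyCompacts X := fun t => ⟨⟨F (r t), hFcpt _ (hr t)⟩, hFne _ (hr t)⟩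
  have hmsum : ∀ P, msum F P = msum (fun t => (C t : Set X)) P := by
    intro P
    refine Finset.sum_congr rfl fun i _ => ?_
    have h1 : P.tag i ∈ Set.Icc (0 : ℝ) 1 := by
      rw [← P.pt_zero, ← P.pt_last]
      exact ⟨(P.pt_mono (Fin.zero_le _)).trans (P.tag_mem i).1,
        (P.tag_mem i).2.trans (P.pt_mono (Fin.le_last _))⟩
    have h2 : r (P.tag i) = P.tag i := congrArg Subtype.val (Set.projIcc_of_mem zero_le_one h1)
    change _ = _ • F (r (P.tag i))
    rw [h2]
  have hlim : limitSets F = limitSets fun t => (C t : Set X) := by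
    simp only [limitSets, hmsum]
  have hCM : ∀ t, ∀ x ∈ C t, ‖x‖ ≤ M := fun t x hx => hM _ (hr t) x hx
  obtain ⟨g, w, hw⟩ := exists_isModel hCM
  obtain ⟨A, hA, hAc, hAφ⟩ := hw.exists_limit hCM
  rw [hlim]
  exact ⟨A, hA, fun B hB l hl => hw.smul_add_smul_mem_limitSets hCM hAc hAφ hB hl⟩
end
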